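/- arXiv:2412.05375 — 10 statements merged into one kernel-verified Lean document; each statement's English description precedes it below -/
import Mathlib

section
/- Let R be a commutative ring and (E,Q) a symplectic module over R. If W ⊆ E is a submodule which is a direct summand of E (the inclusion W ↪ E splits), then W^⊥ is also a direct summand of E. -/
/-- The orthogonal complement `W^⊥ = {x ∈ E : Q(x,w) = 0 for all w ∈ W}` of a submodule `W`
with respect to a bilinear form `Q`. -/
def perpBilin {R E : Type*} [CommRing R] [AddCommGroup E] [Module R E]
    (Q : E →ₗ[R] E →ₗ[R] R) (W : Submodule R E) : Submodule R E :=
  ⨅ (w : E) (_ : w ∈ W), LinearMap.ker (Q.flip w)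

/-- If `(E,Q)` is a symplectic module over a commutative ring `R` and `W ⊆ E` is a
direct summand, then `W^⊥` is a direct summand of `E`. -/
theorem stmt_0 {R E : Type*} [CommRing R] [AddCommGroup E] [Module R E]
    [Module.Finite R E] [Module.Projective R E]
    (Q : E →ₗ[R] E →ₗ[R] R)
    (halt : ∀ x : E, Q x x = 0)
    (hnd : Function.Bijective fun x : E => Q x)
    (W : Submodule R E)
    (hW : ∃ W' : Submodule R E, IsCompl W W') :
    ∃ C : Submodule R E, IsCompl (perpBilin Q W) C := by
  obtain ⟨W', h⟩ := hW
  have mem_perp (V : Submodule R E) (x : E) : x ∈ perpBilin Q V ↔ ∀ w ∈ V, Q x w = 0 := by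
    simp [perpBilin, Submodule.mem_iInf]
  refine ⟨perpBilin Q W', ?_, ?_⟩
  · rw [Submodule.disjoint_def]
    intro x hx hx'
    rw [mem_perp] at hx hx'
    refine hnd.1 (LinearMap.ext fun y => ?_)
    obtain ⟨a, ha, b, hb, rfl⟩ := Submodule.mem_sup.1 (h.sup_eq_top ▸ Submodule.mem_top (x := y))
    simp [hx a ha, hx' b hb]
  · rw [codisjoint_iff, eq_top_iff]
    intro x _
    obtain ⟨y, hy⟩ := hnd.2 (Q x ∘ₗ W'.subtype ∘ₗ W'.projectionOnto W h.symm)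
    have hy' (z : E) : Q y z = Q x (W'.projectionOnto W h.symm z) := LinearMap.congr_fun hy z
    refine Submodule.mem_sup.2 ⟨y, (mem_perp _ _).2 fun w hw => ?_, x - y,
      (mem_perp _ _).2 fun w hw => ?_, add_sub_cancel y x⟩
    · rw [hy', (Submodule.projectionOnto_apply_eq_zero_iff h.symm).2 hw]
      simp
    · have hproj := Submodule.projectionOnto_apply_left h.symm ⟨w, hw⟩
      rw [map_sub, LinearMap.sub_apply, hy', hproj, sub_self]
end

section
/- Let R be a commutative ring and (E,Q) a symplectic module over R equipped with a chain of submodules 0 = F^{−n} ⊆ F^{1−n} ⊆ ⋯ ⊆ F^{n−1} = E such that F^j = (F^{−j−1})^⊥ for all j and each quotient F^i/F^{i−1} is finitely generated projective. Then for every i the map from F^i/F^{i−1} to Hom_R(F^{−i}/F^{−i−1}, R) sending x + F^{i−1} to the functional y + F^{−i−1} ↦ Q(x,y) is well defined and is an isomorphism; in particular Q induces a perfect pairing between F^i/F^{i−1} and F^{−i}/F^{−i−1}. -/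
theorem mem_perpBilin {R E : Type*} [CommRing R] [AddCommGroup E] [Module R E]
    {Q : E →ₗ[R] E →ₗ[R] R} {W : Submodule R E} {x : E} :
    x ∈ perpBilin Q W ↔ ∀ w ∈ W, Q x w = 0 := by
  simp [perpBilin]

/-- A linear map on a submodule `W` extends to a larger submodule `V` if `V / W` is projective. -/
theorem Submodule.exists_extend_of_projective_quotient {R E M : Type*} [CommRing R]
    [AddCommGroup E] [Module R E] [AddCommGroup M] [Module R M] {W V : Submodule R E}
    (hWV : W ≤ V) [Module.Projective R (V ⧸ W.comap V.subtype)] (f : W →ₗ[R] M) :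
    ∃ g : V →ₗ[R] M, ∀ (y : E) (hy : y ∈ W), g ⟨y, hWV hy⟩ = f ⟨y, hy⟩ := by
  obtain ⟨s, hs⟩ := Module.projective_lifting_property (W.comap V.subtype).mkQ LinearMap.id
    (W.comap V.subtype).mkQ_surjective
  have hmem (x : V) : V.subtype (x - s ((W.comap V.subtype).mkQ x)) ∈ W := by
    rw [← Submodule.mem_comap, ← Submodule.Quotient.mk_eq_zero, Submodule.Quotient.mk_sub,
      sub_eq_zero]
    exact (LinearMap.congr_fun hs _).symm
  refine ⟨f ∘ₗ LinearMap.codRestrict W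
    (V.subtype ∘ₗ (LinearMap.id - s ∘ₗ (W.comap V.subtype).mkQ)) hmem, fun y hy => ?_⟩
  have hzero : (W.comap V.subtype).mkQ ⟨y, hWV hy⟩ = 0 := by
    rw [← LinearMap.mem_ker, Submodule.ker_mkQ]
    exact hy
  rw [LinearMap.comp_apply]
  congr 1
  ext
  simp [-Submodule.mkQ_apply, hzero]

/-- If a filtration exhausts `E` at a finite stage and has projective graded pieces, then linear
maps on its steps extend to `E`. -/
theorem exists_extend_of_projective_graded {R E M : Type*} [CommRing R] [AddCommGroup E]
    [Module R E] [AddCommGroup M] [Module R M] {F : ℤ → Submodule R E} (hmono : Monotone F)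
    {m : ℤ} (htop : ∀ j, m ≤ j → F j = ⊤)
    (hproj : ∀ i, Module.Projective R (F i ⧸ (F (i - 1)).comap (F i).subtype))
    (j : ℤ) (f : F j →ₗ[R] M) :
    ∃ g : E →ₗ[R] M, ∀ (y : E) (hy : y ∈ F j), g y = f ⟨y, hy⟩ := by
  obtain ⟨k, hk⟩ : ∃ k : ℕ, m ≤ j + k := ⟨(m - j).toNat, by omega⟩
  induction k generalizing j with
  | zero =>
    have hj := htop j (by simpa using hk)
    exact ⟨f ∘ₗ LinearMap.codRestrict (F j) LinearMap.id (fun x => by simp [hj]),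
      fun y hy => rfl⟩
  | succ k ih =>
    have hp : Module.Projective R (F (j + 1) ⧸ (F j).comap (F (j + 1)).subtype) := by
      have h := hproj (j + 1)
      rwa [add_sub_cancel_right] at h
    have hle : F j ≤ F (j + 1) := hmono (by omega)
    obtain ⟨g, hg⟩ := Submodule.exists_extend_of_projective_quotient hle f
    obtain ⟨h, hh⟩ := ih (j + 1) g (by push_cast at hk; omega)
    exact ⟨h, fun y hy => (hh y (hle hy)).trans (hg y hy)⟩

/-- Let `(E,Q)` be a symplectic module over a commutative ring `R` with a chain of
submodules `0 = F^{-n} ⊆ ⋯ ⊆ F^{n-1} = E` such that `F^j = (F^{-j-1})^⊥` for all `j`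
and each `F^i/F^{i-1}` finitely generated projective.  Then for every `i` the map
`F^i/F^{i-1} → Hom_R(F^{-i}/F^{-i-1}, R)`, `x + F^{i-1} ↦ (y + F^{-i-1} ↦ Q(x,y))`,
is well defined and an isomorphism. -/
theorem stmt_2 {R E : Type*} [CommRing R] [AddCommGroup E] [Module R E]
    [Module.Finite R E] [Module.Projective R E]
    (Q : E →ₗ[R] E →ₗ[R] R)
    (halt : ∀ x : E, Q x x = 0)
    (hnd : Function.Bijective fun x : E => Q x)
    (n : ℕ) (F : ℤ → Submodule R E)
    (hmono : Monotone F)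
    (hbot : ∀ j : ℤ, j ≤ -(n : ℤ) → F j = ⊥)
    (htop : ∀ j : ℤ, (n : ℤ) - 1 ≤ j → F j = ⊤)
    (hperp : ∀ j : ℤ, F j = perpBilin Q (F (-j - 1)))
    (hfg : ∀ i : ℤ,
      Module.Finite R (F i ⧸ (Submodule.comap (F i).subtype (F (i - 1)))))
    (hproj : ∀ i : ℤ,
      Module.Projective R (F i ⧸ (Submodule.comap (F i).subtype (F (i - 1))))) :
    ∀ i : ℤ, ∃ φ : (F i ⧸ (Submodule.comap (F i).subtype (F (i - 1)))) ≃ₗ[R]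
        ((F (-i) ⧸ (Submodule.comap (F (-i)).subtype (F (-i - 1)))) →ₗ[R] R),
      ∀ (x : F i) (y : F (-i)),
        φ (Submodule.Quotient.mk x) (Submodule.Quotient.mk y) = Q (x : E) (y : E) := by
  intro i
  have mem_iff (x : E) : x ∈ F i ↔ ∀ w ∈ F (-i - 1), Q x w = 0 := by
    rw [hperp i, mem_perpBilin]
  have mem_pred_iff (x : E) : x ∈ F (i - 1) ↔ ∀ w ∈ F (-i), Q x w = 0 := by
    rw [hperp (i - 1), mem_perpBilin, show -(i - 1) - 1 = -i by ring]
  let ψ : F i →ₗ[R] (F (-i) ⧸ (F (-i - 1)).comap (F (-i)).subtype) →ₗ[R] R :=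
    { toFun := fun x => Submodule.liftQ _ (Q x ∘ₗ (F (-i)).subtype)
        fun y hy => (mem_iff x).1 x.2 y hy
      map_add' := fun x x' => by ext y; exact LinearMap.congr_fun (map_add Q (x : E) x') y
      map_smul' := fun c x => by ext y; exact LinearMap.congr_fun (map_smul Q c (x : E)) y }
  have hψ (x : F i) (y : F (-i)) : ψ x (Submodule.Quotient.mk y) = Q x y := rfl
  have hker : LinearMap.ker ψ = (F (i - 1)).comap (F i).subtype := by
    ext x
    rw [LinearMap.mem_ker, Submodule.mem_comap, Submodule.subtype_apply, mem_pred_iff]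
    refine ⟨fun h w hw => by rw [← hψ x ⟨w, hw⟩, h, LinearMap.zero_apply], fun h => ?_⟩
    ext y
    exact h y y.2
  have hsurj : Function.Surjective ψ := by
    intro f
    obtain ⟨g, hg⟩ := exists_extend_of_projective_graded hmono htop hproj (-i)
      (f ∘ₗ Submodule.mkQ _)
    obtain ⟨x, rfl⟩ := hnd.2 g
    have hx : x ∈ F i := (mem_iff x).2 fun w hw => by
      have hw' : w ∈ F (-i) := hmono (by omega) hw
      refine (hg w hw').trans ?_
      rw [LinearMap.comp_apply, Submodule.mkQ_apply,
        (Submodule.Quotient.mk_eq_zero _).2 (show (⟨w, hw'⟩ : F (-i)) ∈ _ from hw), map_zero]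
    refine ⟨⟨x, hx⟩, ?_⟩
    ext y
    exact hg y y.2
  exact ⟨(Submodule.quotEquivOfEq _ _ hker.symm).trans (ψ.quotKerEquivOfSurjective hsurj),
    fun x y => rfl⟩
end

section
/- Let R be a commutative ring and (E,Q) a symplectic module over R. Let W ⊆ E be an isotropic submodule (Q(w,w') = 0 for all w, w' ∈ W) such that W, W^⊥/W and E/W^⊥ are all finitely generated projective R-modules. Then (W^⊥)^⊥ = W; consequently the filtration 0 ⊆ F^{−1} = W ⊆ F^{0} = W^⊥ ⊆ F^{1} = E satisfies F^j = (F^{−j−1})^⊥ for all j. -/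
theorem perpBilin_anti {R E : Type*} [CommRing R] [AddCommGroup E] [Module R E]
    (Q : E →ₗ[R] E →ₗ[R] R) {V W : Submodule R E} (h : V ≤ W) :
    perpBilin Q W ≤ perpBilin Q V :=
  fun _ hx => mem_perpBilin.2 fun w hw => mem_perpBilin.1 hx w (h hw)

theorem perpBilin_bot {R E : Type*} [CommRing R] [AddCommGroup E] [Module R E]
    (Q : E →ₗ[R] E →ₗ[R] R) : perpBilin Q ⊥ = ⊤ := by
  simp [perpBilin]

theorem perpBilin_top {R E : Type*} [CommRing R] [AddCommGroup E] [Module R E]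
    {Q : E →ₗ[R] E →ₗ[R] R} (hQ : Function.Injective fun x : E => Q x) :
    perpBilin Q ⊤ = ⊥ := by
  refine (Submodule.eq_bot_iff _).2 fun x hx => hQ ?_
  ext y
  simpa using mem_perpBilin.1 hx y trivial

/-- A submodule with projective quotient admits a projection onto it. -/
theorem Submodule.exists_projection_of_projective_quotient {R E : Type*} [CommRing R]
    [AddCommGroup E] [Module R E] (V : Submodule R E) [Module.Projective R (E ⧸ V)] :
    ∃ p : E →ₗ[R] V, ∀ v : V, p v = v := by
  obtain ⟨s, hs⟩ := Module.projective_lifting_property V.mkQ LinearMap.id V.mkQ_surjective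
  have hmem (x : E) : (LinearMap.id - s ∘ₗ V.mkQ : E →ₗ[R] E) x ∈ V := by
    refine (Submodule.Quotient.mk_eq_zero V).1 ?_
    simpa [sub_eq_zero] using (LinearMap.congr_fun hs (V.mkQ x)).symm
  refine ⟨LinearMap.codRestrict V _ hmem, fun v => Subtype.ext ?_⟩
  simp [(Submodule.Quotient.mk_eq_zero V).2 v.2]

/-- An isotropic submodule `W` for which `W^⊥/W` and `E/W^⊥` are projective equals its
double orthogonal complement. -/
theorem perpBilin_perpBilin_of_isotropic {R E : Type*} [CommRing R] [AddCommGroup E] [Module R E]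
    {Q : E →ₗ[R] E →ₗ[R] R} (halt : Q.IsAlt)
    (hsurj : Function.Surjective fun x : E => Q x) {W : Submodule R E}
    (hW : W ≤ perpBilin Q W)
    [Module.Projective R ((perpBilin Q W) ⧸ (Submodule.comap (perpBilin Q W).subtype W))]
    [Module.Projective R (E ⧸ perpBilin Q W)] :
    perpBilin Q (perpBilin Q W) = W := by
  refine le_antisymm (fun x hx => ?_) fun w hw => mem_perpBilin.2 fun y hy =>
    halt.isRefl _ _ (mem_perpBilin.1 hy w hw)
  obtain ⟨p, hp⟩ := (perpBilin Q W).exists_projection_of_projective_quotient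
  let x' : perpBilin Q W := ⟨x, perpBilin_anti Q hW hx⟩
  have hzero : (Submodule.comap (perpBilin Q W).subtype W).mkQ x' = 0 := by
    refine (Module.forall_dual_apply_eq_zero_iff R _).1 fun g => ?_
    obtain ⟨y, hy⟩ := hsurj (g ∘ₗ (Submodule.comap (perpBilin Q W).subtype W).mkQ ∘ₗ p)
    have hyW : y ∈ perpBilin Q W := by
      refine mem_perpBilin.2 fun w hw => ?_
      have hpw : (Submodule.comap (perpBilin Q W).subtype W).mkQ (p w) = 0 := by
        rw [hp ⟨w, hW hw⟩]
        exact (Submodule.Quotient.mk_eq_zero _).2 hw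
      rw [show Q y = _ from hy, LinearMap.comp_apply, LinearMap.comp_apply, hpw, map_zero]
    have hyx : Q y x = 0 := halt.isRefl _ _ (mem_perpBilin.1 hx y hyW)
    rw [show Q y = _ from hy, LinearMap.comp_apply, LinearMap.comp_apply] at hyx
    rwa [hp x'] at hyx
  exact (Submodule.Quotient.mk_eq_zero (Submodule.comap (perpBilin Q W).subtype W)).1 hzero

/-- Let `(E,Q)` be a symplectic module over a commutative ring `R` and `W ⊆ E` an
isotropic submodule such that `W`, `W^⊥/W` and `E/W^⊥` are finitely generated
projective.  Then `(W^⊥)^⊥ = W`; consequently the filtration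
`0 ⊆ F^{-1} = W ⊆ F^0 = W^⊥ ⊆ F^1 = E` satisfies `F^j = (F^{-j-1})^⊥` for all `j`. -/
theorem stmt_3 {R E : Type*} [CommRing R] [AddCommGroup E] [Module R E]
    [Module.Finite R E] [Module.Projective R E]
    (Q : E →ₗ[R] E →ₗ[R] R)
    (halt : ∀ x : E, Q x x = 0)
    (hnd : Function.Bijective fun x : E => Q x)
    (W : Submodule R E)
    (hiso : ∀ w ∈ W, ∀ w' ∈ W, Q w w' = 0)
    (hWfg : Module.Finite R W) (hWproj : Module.Projective R W)
    (hq1fg : Module.Finite R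
      ((perpBilin Q W) ⧸ (Submodule.comap (perpBilin Q W).subtype W)))
    (hq1proj : Module.Projective R
      ((perpBilin Q W) ⧸ (Submodule.comap (perpBilin Q W).subtype W)))
    (hq2fg : Module.Finite R (E ⧸ perpBilin Q W))
    (hq2proj : Module.Projective R (E ⧸ perpBilin Q W)) :
    perpBilin Q (perpBilin Q W) = W ∧
    ∀ F : ℤ → Submodule R E,
      (∀ j : ℤ, j ≤ -2 → F j = ⊥) → F (-1) = W → F 0 = perpBilin Q W →
      (∀ j : ℤ, 1 ≤ j → F j = ⊤) →
      ∀ j : ℤ, F j = perpBilin Q (F (-j - 1)) := by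
  have hperp : perpBilin Q (perpBilin Q W) = W :=
    perpBilin_perpBilin_of_isotropic halt hnd.surjective
      fun w hw => mem_perpBilin.2 (hiso w hw)
  refine ⟨hperp, fun F hbot hneg hzero htop j => ?_⟩
  obtain hj | rfl | rfl | hj : j ≤ -2 ∨ j = -1 ∨ j = 0 ∨ 1 ≤ j := by omega
  · rw [hbot j hj, htop _ (by omega), perpBilin_top hnd.injective]
  · norm_num [hneg, hzero, hperp]
  · norm_num [hneg, hzero]
  · rw [htop j hj, hbot _ (by omega), perpBilin_bot]
end

section
/- Let R be a commutative ring and (E,Q) a symplectic module over R. Let W ⊆ E be an isotropic submodule (Q(w,w') = 0 for all w, w' ∈ W) such that W, W^⊥/W and E/W^⊥ are finitely generated projective and E/W^⊥ is a free R-module. Suppose a submodule V ⊆ W^⊥ with W^⊥ = W ⊕ V is given. Then there exists a submodule C ⊆ E with E = W^⊥ ⊕ C such that Q(c, v) = 0 for all c ∈ C and v ∈ V, and Q(c, c') = 0 for all c, c' ∈ C. -/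
/-- If `P = W ⊕ V` and `E ⧸ P` is projective, some endomorphism of `E` is the identity on `V`
and zero on `W`. -/
theorem exists_endomorphism_eq_id_of_sup_eq {R E : Type*} [CommRing R] [AddCommGroup E]
    [Module R E] (P W V : Submodule R E) [Module.Projective R (E ⧸ P)]
    (hdisj : W ⊓ V = ⊥) (hsup : W ⊔ V = P) :
    ∃ π : E →ₗ[R] E, (∀ v ∈ V, π v = v) ∧ ∀ w ∈ W, π w = 0 := by
  have hW : W ≤ P := hsup ▸ le_sup_left
  have hV : V ≤ P := hsup ▸ le_sup_right
  obtain ⟨s, hs⟩ := Module.projective_lifting_property P.mkQ LinearMap.id P.mkQ_surjective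
  have hs' (x : E ⧸ P) : P.mkQ (s x) = x := LinearMap.congr_fun hs x
  have hcompl : IsCompl (V.comap P.subtype) (W.comap P.subtype) := by
    constructor
    · rw [Submodule.disjoint_def]
      intro x hxV hxW
      have hx : (x : E) ∈ W ⊓ V := ⟨hxW, hxV⟩
      rw [hdisj] at hx
      exact Subtype.ext hx
    · rw [codisjoint_iff, eq_top_iff]
      intro x _
      obtain ⟨w, hw, v, hv, hwv⟩ := Submodule.mem_sup.mp (hsup.symm ▸ x.2 : (x : E) ∈ W ⊔ V)
      exact Submodule.mem_sup.mpr ⟨⟨v, hV hv⟩, hv, ⟨w, hW hw⟩, hw,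
        Subtype.ext ((add_comm v w).trans hwv)⟩
  have hmem (x : E) : (LinearMap.id - s ∘ₗ P.mkQ : E →ₗ[R] E) x ∈ P := by
    refine (Submodule.Quotient.mk_eq_zero P).mp (?_ : P.mkQ _ = 0)
    simp only [LinearMap.sub_apply, LinearMap.id_apply, LinearMap.comp_apply, map_sub, hs',
      sub_self]
  let r : E →ₗ[R] P := (LinearMap.id - s ∘ₗ P.mkQ).codRestrict P hmem
  have hr (x : E) (hx : x ∈ P) : r x = ⟨x, hx⟩ := by
    have hx0 : P.mkQ x = 0 := (Submodule.Quotient.mk_eq_zero P).mpr hx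
    apply Subtype.ext
    simp only [r, LinearMap.codRestrict_apply, LinearMap.sub_apply, LinearMap.id_apply,
      LinearMap.comp_apply, hx0, map_zero, sub_zero]
  refine ⟨P.subtype ∘ₗ (V.comap P.subtype).subtype ∘ₗ
    Submodule.projectionOnto _ _ hcompl ∘ₗ r, fun v hv => ?_, fun w hw => ?_⟩
  · have h := Submodule.projectionOnto_apply_left hcompl ⟨⟨v, hV hv⟩, hv⟩
    simp only [LinearMap.comp_apply, hr v (hV hv)]
    exact congrArg (fun y : V.comap P.subtype => ((y : P) : E)) h
  · have h := Submodule.projectionOnto_apply_right hcompl ⟨⟨w, hW hw⟩, hw⟩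
    simp only [LinearMap.comp_apply, hr w (hW hw)]
    exact congrArg (fun y : V.comap P.subtype => ((y : P) : E)) h

/-- Let `(E,Q)` be a symplectic module over a commutative ring `R`, and `W ⊆ E` an
isotropic submodule with `W`, `W^⊥/W`, `E/W^⊥` finitely generated projective and
`E/W^⊥` free.  Given `V ⊆ W^⊥` with `W^⊥ = W ⊕ V`, there is a submodule `C` with
`E = W^⊥ ⊕ C`, `Q(c,v) = 0` for `c ∈ C`, `v ∈ V`, and `Q(c,c') = 0` for `c, c' ∈ C`. -/
theorem stmt_4 {R E : Type*} [CommRing R] [AddCommGroup E] [Module R E]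
    [Module.Finite R E] [Module.Projective R E]
    (Q : E →ₗ[R] E →ₗ[R] R)
    (halt : ∀ x : E, Q x x = 0)
    (hnd : Function.Bijective fun x : E => Q x)
    (W V : Submodule R E)
    (hiso : ∀ w ∈ W, ∀ w' ∈ W, Q w w' = 0)
    (hWfg : Module.Finite R W) (hWproj : Module.Projective R W)
    (hq1fg : Module.Finite R
      ((perpBilin Q W) ⧸ (Submodule.comap (perpBilin Q W).subtype W)))
    (hq1proj : Module.Projective R
      ((perpBilin Q W) ⧸ (Submodule.comap (perpBilin Q W).subtype W)))
    (hq2fg : Module.Finite R (E ⧸ perpBilin Q W))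
    (hq2proj : Module.Projective R (E ⧸ perpBilin Q W))
    (hq2free : Module.Free R (E ⧸ perpBilin Q W))
    (hV : V ≤ perpBilin Q W)
    (hVW1 : W ⊓ V = ⊥) (hVW2 : W ⊔ V = perpBilin Q W) :
    ∃ C : Submodule R E,
      (perpBilin Q W) ⊓ C = ⊥ ∧ (perpBilin Q W) ⊔ C = ⊤ ∧
      (∀ c ∈ C, ∀ v ∈ V, Q c v = 0) ∧
      (∀ c ∈ C, ∀ c' ∈ C, Q c c' = 0) := by
  classical
  have hmem {x : E} : x ∈ perpBilin Q W ↔ ∀ w ∈ W, Q x w = 0 := mem_perpBilin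
  set P := perpBilin Q W
  have hskew (x y : E) : Q x y = -Q y x := (LinearMap.IsAlt.neg halt y x).symm
  have hmk {x : E} : P.mkQ x = 0 ↔ x ∈ P := Submodule.Quotient.mk_eq_zero P
  have hWP : W ≤ P := hVW2 ▸ le_sup_left
  obtain ⟨π, hπV, hπW⟩ := exists_endomorphism_eq_id_of_sup_eq P W V hVW1 hVW2
  have hlift (x : E ⧸ P) : ∃ e : E, P.mkQ e = x ∧ ∀ v ∈ V, Q e v = 0 := by
    obtain ⟨y, rfl⟩ := P.mkQ_surjective x
    obtain ⟨p, hp⟩ := hnd.2 (Q y ∘ₗ π)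
    have hp' (z : E) : Q p z = Q y (π z) := LinearMap.congr_fun hp z
    have hpP : p ∈ P := hmem.mpr fun w hw => by rw [hp', hπW w hw, map_zero]
    refine ⟨y - p, by rw [map_sub, hmk.mpr hpP, sub_zero], fun v hv => ?_⟩
    rw [map_sub, LinearMap.sub_apply, hp', hπV v hv, sub_self]
  let b := Module.Free.chooseBasis R (E ⧸ P)
  let := linearOrderOfSTO (WellOrderingRel (α := Module.Free.ChooseBasisIndex R (E ⧸ P)))
  choose e he heV using fun i => hlift (b i)
  have hdecomp (x : E) : ∃ p ∈ P, ∃ c : E, (∀ v ∈ V, Q c v = 0) ∧ x = p + c := by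
    let s := b.constr ℕ e
    have hs : P.mkQ ∘ₗ s = LinearMap.id := b.ext fun i => by simp [s, he]
    have hsV (v : E) (hv : v ∈ V) : Q.flip v ∘ₗ s = 0 :=
      b.ext fun i => by simp [s, heV i v hv]
    refine ⟨x - s (P.mkQ x), hmk.mp ?_, s (P.mkQ x),
      fun v hv => LinearMap.congr_fun (hsV v hv) _, (sub_add_cancel _ _).symm⟩
    rw [map_sub, sub_eq_zero]
    exact (LinearMap.congr_fun hs _).symm
  have hdouble (x : E) (hx : ∀ p ∈ P, Q x p = 0) : x ∈ W := by
    have hxP : x ∈ W ⊔ V := hVW2.symm ▸ hmem.mpr fun w hw => hx w (hWP hw)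
    obtain ⟨w, hw, v, hv, rfl⟩ := Submodule.mem_sup.mp hxP
    have hv0 : v = 0 := by
      refine hnd.1 (LinearMap.ext fun y => ?_)
      obtain ⟨p, hp, c, hc, rfl⟩ := hdecomp y
      have h₁ := hx p hp
      have h₂ : Q w p = 0 := by rw [hskew, hmem.mp hp w hw, neg_zero]
      rw [map_add, LinearMap.add_apply, h₂, zero_add] at h₁
      simp [h₁, hskew v c, hc v hv]
    simpa [hv0] using hw
  have hcorr (i) : ∃ w ∈ W, ∀ j, Q w (e j) = if i < j then -Q (e i) (e j) else 0 := by
    let g : (E ⧸ P) →ₗ[R] R := b.constr ℕ fun j => if i < j then -Q (e i) (e j) else 0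
    obtain ⟨w, hw⟩ := hnd.2 (g ∘ₗ P.mkQ)
    have hw' (z : E) : Q w z = g (P.mkQ z) := LinearMap.congr_fun hw z
    refine ⟨w, hdouble w fun p hp => by rw [hw', hmk.mpr hp, map_zero], fun j => ?_⟩
    rw [hw', he, b.constr_basis]
  choose w hwW hwe using hcorr
  let s : (E ⧸ P) →ₗ[R] E := b.constr ℕ fun i => e i + w i
  have hsb (i) : s (b i) = e i + w i := b.constr_basis ℕ _ i
  have hs : P.mkQ ∘ₗ s = LinearMap.id := b.ext fun i => by
    rw [LinearMap.comp_apply, hsb, map_add, he, hmk.mpr (hWP (hwW i)), add_zero,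
      LinearMap.id_apply]
  have hsV (v : E) (hv : v ∈ V) : Q.flip v ∘ₗ s = 0 := b.ext fun i => by
    have h : Q (w i) v = 0 := by rw [hskew, hmem.mp (hV hv) _ (hwW i), neg_zero]
    simp [hsb, heV i v hv, h]
  have hss : Q.compl₁₂ s s = 0 := b.ext fun i => b.ext fun j => by
    have hji := hwe j i
    have hij := hwe i j
    have h₀ := hiso _ (hwW i) _ (hwW j)
    simp only [LinearMap.compl₁₂_apply, hsb, map_add, LinearMap.add_apply, h₀,
      LinearMap.zero_apply, hskew (e i) (w j), hji, hij]
    rcases lt_trichotomy i j with h | rfl | h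
    · simp [h, h.not_gt]
    · simp [halt]
    · simp [h, h.not_gt, hskew (e i) (e j)]
  refine ⟨LinearMap.range s, ?_, ?_, ?_, ?_⟩
  · rw [eq_bot_iff]
    rintro _ ⟨hx, y, rfl⟩
    have hy : y = 0 := (LinearMap.congr_fun hs y).symm.trans (hmk.mpr hx)
    simp [hy]
  · rw [eq_top_iff]
    intro x _
    refine Submodule.mem_sup.mpr ⟨x - s (P.mkQ x), hmk.mp ?_, _, ⟨P.mkQ x, rfl⟩,
      sub_add_cancel _ _⟩
    rw [map_sub, sub_eq_zero]
    exact (LinearMap.congr_fun hs _).symm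
  · rintro _ ⟨y, rfl⟩ v hv
    exact LinearMap.congr_fun (hsV v hv) y
  · rintro _ ⟨y, rfl⟩ _ ⟨z, rfl⟩
    exact LinearMap.congr_fun (LinearMap.congr_fun hss y) z
end

section
/- Let R be a commutative ring and (E,Q) a symplectic module over R equipped with a chain of submodules 0 = F^{−n} ⊆ F^{1−n} ⊆ ⋯ ⊆ F^{n−1} = E such that F^j = (F^{−j−1})^⊥ for all j, and suppose each quotient F^i/F^{i−1} is a finitely generated free R-module. Then there exist submodules E_i ⊆ E for 1−n ≤ i ≤ n−1 such that E = ⊕_i E_i, F^k = ⊕_{i ≤ k} E_i for every k, Q(E_i, E_j) = 0 whenever j ≠ −i, and for each i the map E_i → Hom_R(E_{−i}, R), x ↦ Q(x,·)|_{E_{−i}}, is an isomorphism. -/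
/-- An alternating bilinear form on a finitely generated projective module is the
antisymmetrization of a bilinear form. -/
theorem exists_eq_sub_flip_of_alternating {R E : Type*} [CommRing R] [AddCommGroup E] [Module R E]
    [Module.Finite R E] [Module.Projective R E] (b : E →ₗ[R] E →ₗ[R] R) (hb : ∀ x, b x x = 0) :
    ∃ β : E →ₗ[R] E →ₗ[R] R, ∀ x y, b x y = β x y - β y x := by
  obtain ⟨m, f, g, -, -, hfg⟩ := Module.Finite.exists_comp_eq_id_of_projective R E
  have hskew : ∀ x y, b x y = -b y x := fun x y => (LinearMap.IsAlt.neg hb y x).symm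
  let B : (Fin m → R) →ₗ[R] (Fin m → R) →ₗ[R] R := b.compl₁₂ f f
  let M : Matrix (Fin m) (Fin m) R :=
    Matrix.of fun i j => if i < j then B (Pi.single i 1) (Pi.single j 1) else 0
  let β : LinearMap.BilinForm R (Fin m → R) := Matrix.toBilin' M
  have key : B = β - LinearMap.flip β := by
    refine LinearMap.BilinForm.ext_basis (Pi.basisFun R (Fin m)) fun i j => ?_
    simp only [Pi.basisFun_apply, LinearMap.sub_apply, LinearMap.flip_apply, β,
      Matrix.toBilin'_single, M, Matrix.of_apply]
    rcases lt_trichotomy i j with h | h | h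
    · simp [h, h.not_gt]
    · subst h
      simp [B, hb]
    · simp only [h, h.not_gt, if_true, if_false, zero_sub]
      exact hskew (f (Pi.single i 1)) (f (Pi.single j 1))
  refine ⟨β.compl₁₂ g g, fun x y => ?_⟩
  have h := LinearMap.congr_fun₂ key (g x) (g y)
  have hx : ∀ z, f (g z) = z := fun z => LinearMap.congr_fun hfg z
  simpa [B, hx] using h

section Filtration

variable {R E : Type*} [CommRing R] [AddCommGroup E] [Module R E]

/-- A submodule `V ≤ W` with projective quotient is complemented in any complemented `W`. -/
theorem exists_isProj_of_isProj_of_projective {V W : Submodule R E} (hVW : V ≤ W)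
    [Module.Projective R (W ⧸ V.comap W.subtype)] {p : Module.End R E}
    (hp : LinearMap.IsProj W p) : ∃ q : Module.End R E, LinearMap.IsProj V q := by
  obtain ⟨s, hs⟩ := Module.projective_lifting_property (V.comap W.subtype).mkQ LinearMap.id
    (Submodule.mkQ_surjective _)
  let r : W →ₗ[R] E := W.subtype ∘ₗ (LinearMap.id - s ∘ₗ (V.comap W.subtype).mkQ)
  refine ⟨r ∘ₗ p.codRestrict W hp.map_mem, ⟨fun x => ?_, fun x hx => ?_⟩⟩
  · have h : (p.codRestrict W hp.map_mem x) - s ((V.comap W.subtype).mkQ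
        (p.codRestrict W hp.map_mem x)) ∈ V.comap W.subtype := by
      refine (Submodule.Quotient.eq _).1 ?_
      exact (LinearMap.congr_fun hs _).symm
    exact h
  · have hpx : p.codRestrict W hp.map_mem x = ⟨x, hVW hx⟩ :=
      Subtype.ext (hp.map_id x (hVW hx))
    have h0 : (V.comap W.subtype).mkQ ⟨x, hVW hx⟩ = 0 := by
      rw [← LinearMap.mem_ker, Submodule.ker_mkQ]
      exact hx
    simp only [LinearMap.comp_apply, hpx, r, LinearMap.sub_apply, h0, map_zero, sub_zero]
    rfl

/-- A filtration that is eventually everything and has projective graded pieces admits a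
compatible system of projections. -/
theorem exists_compatible_isProj (F : ℤ → Submodule R E) (hmono : Monotone F) (N : ℤ)
    (htop : ∀ j, N ≤ j → F j = ⊤)
    (hproj : ∀ i, Module.Projective R (F i ⧸ (F (i - 1)).comap (F i).subtype)) :
    ∃ π : ℤ → Module.End R E, (∀ j, LinearMap.IsProj (F j) (π j)) ∧
      ∀ i j, i ≤ j → π i * π j = π i := by
  have hσ : ∀ m : ℕ, ∃ q : Module.End R E, LinearMap.IsProj (F (N - m)) q := by
    intro m
    induction m with
    | zero => exact ⟨1, ⟨fun x => by simp [htop N le_rfl], fun x _ => rfl⟩⟩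
    | succ m ih =>
      obtain ⟨p, hp⟩ := ih
      have := hproj (N - m)
      have h := exists_isProj_of_isProj_of_projective (hmono (by omega : N - m - 1 ≤ N - m)) hp
      rwa [show N - ((m + 1 : ℕ) : ℤ) = N - m - 1 by push_cast; ring]
  choose σ hσ using hσ
  let a : ℕ → Module.End R E := fun m => Nat.rec 1 (fun m f => σ (m + 1) * f) m
  have ha_succ : ∀ m, a (m + 1) = σ (m + 1) * a m := fun _ => rfl
  have ha : ∀ m : ℕ, LinearMap.IsProj (F (N - m)) (a m) := by
    intro m
    induction m with
    | zero => exact ⟨fun x => by simp [htop N le_rfl], fun x _ => rfl⟩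
    | succ m ih =>
      refine ⟨fun x => (hσ (m + 1)).map_mem _, fun x hx => ?_⟩
      rw [ha_succ, Module.End.mul_apply,
        ih.map_id x (hmono (by omega) hx), (hσ (m + 1)).map_id x hx]
  have hcomp : ∀ m k : ℕ, m ≤ k → a k * a m = a k := by
    intro m k hmk
    induction k, hmk using Nat.le_induction with
    | base => exact LinearMap.ext fun x => (ha m).map_id _ ((ha m).map_mem x)
    | succ k _ ih => rw [ha_succ, mul_assoc, ih]
  refine ⟨fun j => a (N - j).toNat, fun j => ?_, fun i j hij => hcomp _ _ (by omega)⟩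
  rcases le_total N j with h | h
  · beta_reduce
    rw [show (N - j).toNat = 0 by omega, htop j h]
    exact ⟨fun _ => trivial, fun _ _ => rfl⟩
  · have := ha (N - j).toNat
    rwa [show N - ((N - j).toNat : ℤ) = j by omega] at this

/-- Taking adjoints with respect to a nondegenerate alternating form is an anti-involution of the
endomorphism ring. -/
theorem exists_adjoint_of_alternating (Q : E →ₗ[R] E →ₗ[R] R) (halt : ∀ x, Q x x = 0)
    (hnd : Function.Bijective fun x => Q x) :
    ∃ S : Module.End R E → Module.End R E, (∀ A x y, Q (S A x) y = Q x (A y)) ∧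
      (∀ A x y, Q (A x) y = Q x (S A y)) ∧ (∀ A B, S (A * B) = S B * S A) ∧
      (∀ A B, S (A - B) = S A - S B) ∧ S 1 = 1 ∧ ∀ A, S (S A) = A := by
  have hskew : ∀ x y, Q x y = -Q y x := fun x y => (LinearMap.IsAlt.neg halt y x).symm
  have hext : ∀ x x', (∀ y, Q x y = Q x' y) → x = x' := fun x x' h => hnd.1 (LinearMap.ext h)
  let e : E ≃ₗ[R] (E →ₗ[R] R) := LinearEquiv.ofBijective Q hnd
  have he : ∀ f y, Q (e.symm f) y = f y := fun f y => LinearMap.congr_fun (e.apply_symm_apply f) y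
  let S : Module.End R E → Module.End R E := fun A =>
    e.symm.toLinearMap ∘ₗ (LinearMap.lcomp R R A) ∘ₗ Q
  have h1 : ∀ A x y, Q (S A x) y = Q x (A y) := fun A x y => he _ _
  have h2 : ∀ A x y, Q (A x) y = Q x (S A y) := fun A x y => by
    rw [hskew, ← h1, ← hskew]
  refine ⟨S, h1, h2, fun A B => ?_, fun A B => ?_, ?_, fun A => ?_⟩ <;>
    refine LinearMap.ext fun x => hext _ _ fun y => ?_
  · simp [h1]
  · simp [h1]
  · simp [h1]
  · rw [h1, h2]

/-- A projection onto an isotropic submodule can be corrected so that the range of its adjoint is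
isotropic as well. -/
theorem exists_isProj_mul_adjoint_eq_zero [Module.Finite R E] [Module.Projective R E]
    {Q : E →ₗ[R] E →ₗ[R] R} (halt : ∀ x, Q x x = 0) (hnd : Function.Bijective fun x => Q x)
    {S : Module.End R E → Module.End R E} (h1 : ∀ A x y, Q (S A x) y = Q x (A y))
    (h2 : ∀ A x y, Q (A x) y = Q x (S A y)) (hmul : ∀ A B, S (A * B) = S B * S A)
    (hsub : ∀ A B, S (A - B) = S A - S B) (hinv : ∀ A, S (S A) = A)
    {L : Submodule R E} (hL : ∀ x ∈ L, ∀ y ∈ L, Q x y = 0)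
    {q : Module.End R E} (hq : LinearMap.IsProj L q) :
    ∃ p : Module.End R E, LinearMap.IsProj L p ∧ p * S p = 0 := by
  have hskew : ∀ x y, Q x y = -Q y x := fun x y => (LinearMap.IsAlt.neg halt y x).symm
  have hext : ∀ x x', (∀ y, Q x y = Q x' y) → x = x' := fun x x' h => hnd.1 (LinearMap.ext h)
  let e : E ≃ₗ[R] (E →ₗ[R] R) := LinearEquiv.ofBijective Q hnd
  have he : ∀ f y, Q (e.symm f) y = f y := fun f y => LinearMap.congr_fun (e.apply_symm_apply f) y
  obtain ⟨β, hβ⟩ := exists_eq_sub_flip_of_alternating (Q.compl₁₂ (S q) (S q)) fun x => halt _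
  let t : Module.End R E := e.symm.toLinearMap ∘ₗ β
  have ht : ∀ x y, Q (t x) y = β x y := fun x y => he _ _
  have hqq : q * q = q := LinearMap.ext fun x => hq.map_id _ (hq.map_mem x)
  have hSq : S q * S q = S q := by rw [← hmul, hqq]
  have hSL : ∀ x ∈ L, S q x = 0 := fun x hx => hext _ _ fun y => by
    rw [h1, hL x hx _ (hq.map_mem y), map_zero, LinearMap.zero_apply]
  have hSqq : S q * q = 0 := LinearMap.ext fun x => hSL _ (hq.map_mem x)
  have hdec : q * S q = t + S t := LinearMap.ext fun x => hext _ _ fun y => by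
    have := hβ x y
    rw [LinearMap.compl₁₂_apply] at this
    rw [Module.End.mul_apply, h2, this, LinearMap.add_apply, map_add, LinearMap.add_apply, h1, ht,
      hskew x, ht, sub_eq_add_neg]
  refine ⟨q - q * t * S q, ⟨fun x => L.sub_mem (hq.map_mem x) (hq.map_mem _), fun x hx => ?_⟩, ?_⟩
  · simp [hSL x hx, hq.map_id x hx]
  · rw [hsub, hmul, hmul, hinv]
    calc (q - q * t * S q) * (S q - q * (S t * S q))
        = q * S q - (q * q) * S t * S q - q * t * (S q * S q)
          + q * t * (S q * q) * S t * S q := by noncomm_ring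
      _ = (q * q) * (S q * S q) - q * (t + S t) * S q := by
          rw [hqq, hSq, hSqq]; noncomm_ring
      _ = 0 := by rw [← hdec]; noncomm_ring

/-- A self-dual filtration with projective graded pieces admits a compatible system of projections
which is stable under adjoints. -/
theorem exists_compatible_isProj_adjoint [Module.Finite R E] [Module.Projective R E]
    {Q : E →ₗ[R] E →ₗ[R] R} (halt : ∀ x, Q x x = 0) (hnd : Function.Bijective fun x => Q x)
    {S : Module.End R E → Module.End R E} (h1 : ∀ A x y, Q (S A x) y = Q x (A y))
    (h2 : ∀ A x y, Q (A x) y = Q x (S A y)) (hmul : ∀ A B, S (A * B) = S B * S A)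
    (hsub : ∀ A B, S (A - B) = S A - S B) (hone : S 1 = 1) (hinv : ∀ A, S (S A) = A)
    (F : ℤ → Submodule R E) (hmono : Monotone F) (N : ℤ) (htop : ∀ j, N ≤ j → F j = ⊤)
    (hmem : ∀ j x, x ∈ F j ↔ ∀ w ∈ F (-j - 1), Q x w = 0)
    (hproj : ∀ i, Module.Projective R (F i ⧸ (F (i - 1)).comap (F i).subtype)) :
    ∃ π : ℤ → Module.End R E, (∀ j, LinearMap.IsProj (F j) (π j)) ∧
      (∀ i j, i ≤ j → π i * π j = π i) ∧ ∀ j, S (π j) = 1 - π (-j - 1) := by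
  have hext : ∀ x x', (∀ y, Q x y = Q x' y) → x = x' := fun x x' h => hnd.1 (LinearMap.ext h)
  have hiso : ∀ i j, i + j < 0 → ∀ x ∈ F i, ∀ y ∈ F j, Q x y = 0 := fun i j hij x hx y hy =>
    (hmem i x).1 hx y (hmono (by omega) hy)
  obtain ⟨ρ, hρ, hρρ⟩ := exists_compatible_isProj F hmono N htop hproj
  obtain ⟨p, hp, hpS⟩ := exists_isProj_mul_adjoint_eq_zero halt hnd h1 h2 hmul hsub hinv
    (hiso (-1) (-1) (by omega)) (hρ (-1))
  have hτ : ∀ j, j < 0 → LinearMap.IsProj (F j) (ρ j * p) := fun j hj =>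
    ⟨fun x => (hρ j).map_mem _, fun x hx => by
      rw [Module.End.mul_apply, hp.map_id x (hmono (by omega) hx), (hρ j).map_id x hx]⟩
  let π : ℤ → Module.End R E := fun j => if j < 0 then ρ j * p else 1 - S (ρ (-j - 1) * p)
  have hneg : ∀ j, j < 0 → π j = ρ j * p := fun j hj => if_pos hj
  have hnonneg : ∀ j, 0 ≤ j → π j = 1 - S (π (-j - 1)) := fun j hj => by
    rw [hneg (-j - 1) (by omega)]
    exact if_neg (by omega)
  have hstar : ∀ j, S (π j) = 1 - π (-j - 1) := fun j => by
    rcases lt_or_ge j 0 with hj | hj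
    · rw [hnonneg (-j - 1) (by omega), show -(-j - 1) - 1 = j by ring]
      abel
    · rw [hnonneg j hj, hsub, hone, hinv]
  have hπneg : ∀ j, j < 0 → LinearMap.IsProj (F j) (π j) := fun j hj => by
    rw [hneg j hj]
    exact hτ j hj
  have hπ : ∀ j, LinearMap.IsProj (F j) (π j) := fun j => by
    rcases lt_or_ge j 0 with hj | hj
    · exact hπneg j hj
    · have hk := hπneg (-j - 1) (by omega)
      rw [hnonneg j hj]
      refine ⟨fun x => (hmem j _).2 fun w hw => ?_, fun x hx => ?_⟩
      · simp [h1, hk.map_id w hw]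
      · have : S (π (-j - 1)) x = 0 := hext _ _ fun y => by
          rw [h1, (hmem j x).1 hx _ (hk.map_mem y), map_zero, LinearMap.zero_apply]
        simp [this]
  have hle_neg : ∀ i j, i ≤ j → j < 0 → π i * π j = π i := fun i j hij hj => by
    have hpρ : p * (ρ j * p) = ρ j * p := LinearMap.ext fun x =>
      hp.map_id _ (hmono (by omega : j ≤ -1) ((hρ j).map_mem _))
    rw [hneg i (by omega), hneg j hj, mul_assoc, hpρ, ← mul_assoc, hρρ i j hij]
  have hle : ∀ i j, i ≤ j → π i * π j = π i := fun i j hij => by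
    rcases lt_or_ge i 0 with hi | hi
    · rcases lt_or_ge j 0 with hj | hj
      · exact hle_neg i j hij hj
      · rw [hnonneg j hj, hneg (-j - 1) (by omega), hneg i hi, hmul, mul_sub, mul_one,
          mul_assoc, ← mul_assoc p, hpS, zero_mul, mul_zero, sub_zero]
    · have h := congrArg S (hle_neg (-j - 1) (-i - 1) (by omega) (by omega))
      rw [hmul, hstar, hstar, show -(-j - 1) - 1 = j by ring,
        show -(-i - 1) - 1 = i by ring] at h
      have hexp : (1 - π i) * (1 - π j) = 1 - π j - π i + π i * π j := by noncomm_ring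
      rw [hexp] at h
      have := sub_eq_zero.2 h
      rw [← sub_eq_zero, ← this]
      abel
  exact ⟨π, hπ, hle, hstar⟩

end Filtration

/-- Let `(E,Q)` be a symplectic module over a commutative ring `R` with a chain of
submodules `0 = F^{-n} ⊆ ⋯ ⊆ F^{n-1} = E` satisfying `F^j = (F^{-j-1})^⊥`, all of whose
graded pieces `F^i/F^{i-1}` are finitely generated free.  Then there exist submodules
`E_i ⊆ E` (for `1-n ≤ i ≤ n-1`, zero outside this range) with `E = ⊕_i E_i`,
`F^k = ⊕_{i ≤ k} E_i`, `Q(E_i, E_j) = 0` for `j ≠ -i`, and for each `i` the map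
`E_i → Hom_R(E_{-i}, R)`, `x ↦ Q(x,·)|_{E_{-i}}`, an isomorphism. -/
theorem stmt_5 {R E : Type*} [CommRing R] [AddCommGroup E] [Module R E]
    [Module.Finite R E] [Module.Projective R E]
    (Q : E →ₗ[R] E →ₗ[R] R)
    (halt : ∀ x : E, Q x x = 0)
    (hnd : Function.Bijective fun x : E => Q x)
    (n : ℕ) (F : ℤ → Submodule R E)
    (hmono : Monotone F)
    (hbot : ∀ j : ℤ, j ≤ -(n : ℤ) → F j = ⊥)
    (htop : ∀ j : ℤ, (n : ℤ) - 1 ≤ j → F j = ⊤)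
    (hperp : ∀ j : ℤ, F j = perpBilin Q (F (-j - 1)))
    (hfg : ∀ i : ℤ,
      Module.Finite R (F i ⧸ (Submodule.comap (F i).subtype (F (i - 1)))))
    (hfree : ∀ i : ℤ,
      Module.Free R (F i ⧸ (Submodule.comap (F i).subtype (F (i - 1))))) :
    ∃ Esub : ℤ → Submodule R E,
      DirectSum.IsInternal Esub ∧
      (∀ i : ℤ, (i < 1 - (n : ℤ) ∨ (n : ℤ) - 1 < i) → Esub i = ⊥) ∧
      (∀ k : ℤ, F k = ⨆ (i : ℤ) (_ : i ≤ k), Esub i) ∧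
      (∀ i j : ℤ, j ≠ -i → ∀ x ∈ Esub i, ∀ y ∈ Esub j, Q x y = 0) ∧
      (∀ i : ℤ, Function.Bijective
        (⇑(LinearMap.compl₁₂ Q (Esub i).subtype ((Esub (-i)).subtype)))) := by
  have hext : ∀ x x', (∀ y, Q x y = Q x' y) → x = x' := fun x x' h => hnd.1 (LinearMap.ext h)
  obtain ⟨S, h1, h2, hmul, hsub, hone, hinv⟩ := exists_adjoint_of_alternating Q halt hnd
  obtain ⟨π, hπ, hle, hstar⟩ := exists_compatible_isProj_adjoint halt hnd h1 h2 hmul hsub hone hinv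
    F hmono (n - 1) htop (fun j x => by rw [hperp j]; simp [perpBilin]) fun i =>
      have := hfree i
      inferInstance
  have hge : ∀ i j, i ≤ j → π j * π i = π i := fun i j hij =>
    LinearMap.ext fun x => (hπ j).map_id _ (hmono hij ((hπ i).map_mem x))
  have hzero : ∀ j : ℤ, j ≤ -(n : ℤ) → π j = 0 := fun j hj => LinearMap.ext fun x => by
    have := (hπ j).map_mem x
    rwa [hbot j hj, Submodule.mem_bot] at this
  have htotal : ∀ j : ℤ, (n : ℤ) - 1 ≤ j → π j = 1 := fun j hj => LinearMap.ext fun x =>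
    (hπ j).map_id x (by rw [htop j hj]; trivial)
  let e : ℤ → Module.End R E := fun i => π i - π (i - 1)
  have he : ∀ i, e i = π i - π (i - 1) := fun _ => rfl
  have heS : ∀ i, S (e i) = e (-i) := fun i => by
    rw [he, he, hsub, hstar, hstar, show -(i - 1) - 1 = -i by ring]
    abel
  have hidem : ∀ i, e i * e i = e i := fun i => by
    rw [he, sub_mul, mul_sub, mul_sub, hle i i le_rfl, hle (i - 1) (i - 1) le_rfl,
      hle (i - 1) i (by omega), hge (i - 1) i (by omega)]
    abel
  have horth : ∀ i j, i ≠ j → e i * e j = 0 := fun i j hij => by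
    rw [he, he, sub_mul, mul_sub, mul_sub]
    rcases lt_or_gt_of_ne hij with h | h
    · rw [hle i j (by omega), hle i (j - 1) (by omega), hle (i - 1) j (by omega),
        hle (i - 1) (j - 1) (by omega)]
      abel
    · rw [hge j i (by omega), hge (j - 1) i (by omega), hge j (i - 1) (by omega),
        hge (j - 1) (i - 1) (by omega)]
      abel
  have hfix : ∀ i, ∀ x ∈ LinearMap.range (e i), e i x = x := by
    rintro i _ ⟨x, rfl⟩
    exact LinearMap.congr_fun (hidem i) x
  have hkill : ∀ i j, i ≠ j → LinearMap.range (e j) ≤ LinearMap.ker (e i) := by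
    rintro i j hij _ ⟨x, rfl⟩
    exact LinearMap.congr_fun (horth i j hij) x
  have hF : ∀ k : ℤ, F k = ⨆ (i : ℤ) (_ : i ≤ k), LinearMap.range (e i) := by
    intro k
    apply le_antisymm
    · have hind : ∀ (m : ℕ) (x : E), π (-n + m) x ∈
          ⨆ (i : ℤ) (_ : i ≤ -n + m), LinearMap.range (e i) := by
        intro m x
        induction m with
        | zero => simp [hzero (-n) le_rfl]
        | succ m ih =>
          have hx : π (-n + (m + 1 : ℕ)) x = e (-n + (m + 1 : ℕ)) x + π (-n + m) x := by
            rw [he, show -(n : ℤ) + (m + 1 : ℕ) - 1 = -n + m by push_cast; ring]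
            simp
          rw [hx]
          refine Submodule.add_mem _ ?_ ?_
          · exact Submodule.mem_iSup_of_mem _ (Submodule.mem_iSup_of_mem le_rfl ⟨x, rfl⟩)
          · refine (?_ : _ ≤ (_ : Submodule R E)) ih
            exact biSup_mono fun i (hi : i ≤ -(n : ℤ) + m) => by push_cast; omega
      rcases le_total k (-n) with hk | hk
      · rw [hbot k hk]
        exact bot_le
      · intro x hx
        have h := hind (k + n).toNat x
        rw [show -(n : ℤ) + (k + n).toNat = k by omega, (hπ k).map_id x hx] at h
        exact h
    · refine iSup₂_le fun i hi => ?_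
      rintro _ ⟨x, rfl⟩
      exact (F k).sub_mem (hmono hi ((hπ i).map_mem x)) (hmono (by omega) ((hπ (i - 1)).map_mem x))
  refine ⟨fun i => LinearMap.range (e i), ?_, ?_, hF, ?_, ?_⟩
  · refine (DirectSum.isInternal_submodule_iff_iSupIndep_and_iSup_eq_top _).2 ⟨fun i => ?_, ?_⟩
    · rw [Submodule.disjoint_def]
      intro x hx hx'
      have h : x ∈ LinearMap.ker (e i) := (iSup₂_le fun j hj => hkill i j hj.symm) hx'
      rw [← hfix i x hx]
      exact h
    · rw [eq_top_iff, ← htop _ le_rfl, hF]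
      exact iSup_mono fun i => iSup_le fun _ => le_rfl
  · rintro i (hi | hi)
    · simp [he, hzero i (by omega), hzero (i - 1) (by omega)]
    · simp [he, htotal i (by omega), htotal (i - 1) (by omega)]
  · rintro i j hij _ ⟨x, rfl⟩ _ ⟨y, rfl⟩
    rw [h2, heS, ← Module.End.mul_apply, horth _ _ hij.symm, LinearMap.zero_apply, map_zero]
  · intro i
    constructor
    · refine (injective_iff_map_eq_zero _).2 fun x hx => Subtype.ext (hext _ _ fun y => ?_)
      have h := LinearMap.congr_fun hx ⟨e (-i) y, y, rfl⟩
      rw [← hfix i x x.2, h2, heS, ZeroMemClass.coe_zero, map_zero]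
      exact h
    · intro f
      obtain ⟨x, hx⟩ := hnd.2 (f ∘ₗ (e (-i)).rangeRestrict)
      refine ⟨⟨e i x, x, rfl⟩, LinearMap.ext fun y => ?_⟩
      have h : Q x y = f ((e (-i)).rangeRestrict y) := LinearMap.congr_fun hx y
      have hy : (e (-i)).rangeRestrict y = y := Subtype.ext (hfix _ _ y.2)
      change Q (e i x) y = f y
      rw [h2, heS, hfix _ _ y.2, h, hy]
end

section
/- Let M be a module over a commutative ring and θ an endomorphism of M with θ^n = 0 and θ^{n−1} ≠ 0. Then for every l with 0 ≤ l ≤ n−1 the map θ^l maps C^l(M) onto C^{−l}(M), and the induced map C^l(M)/C^{l−1}(M) → C^{−l}(M)/C^{−l−1}(M) is an isomorphism. -/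
/-- For a nilpotent endomorphism `θ` with `θ^n = 0`, the canonical filtration
`C^l(M) = Σ_{i-j = l, 0 ≤ i ≤ n, 1 ≤ j ≤ n+1} ker(θ^i) ∩ im(θ^{j-1})`. -/
def Cfilt {R M : Type*} [CommRing R] [AddCommGroup M] [Module R M]
    (θ : M →ₗ[R] M) (n : ℕ) (l : ℤ) : Submodule R M :=
  ⨆ (p : ℕ × ℕ) (_ : (p.1 : ℤ) - (p.2 : ℤ) = l ∧ p.1 ≤ n ∧ 1 ≤ p.2 ∧ p.2 ≤ n + 1),
    LinearMap.ker (θ ^ p.1) ⊓ LinearMap.range (θ ^ (p.2 - 1))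

section

variable {R M : Type*} [CommRing R] [AddCommGroup M] [Module R M]

theorem ker_inf_range_le_Cfilt {θ : M →ₗ[R] M} {n : ℕ} (hnil : θ ^ n = 0) {k : ℤ}
    (hk : k ≤ (n : ℤ) - 1) {a b : ℕ} (hab : (a : ℤ) = b + k + 1) :
    LinearMap.ker (θ ^ a) ⊓ LinearMap.range (θ ^ b) ≤ Cfilt θ n k := by
  by_cases hb : n < b
  · rintro _ ⟨-, z, rfl⟩
    simp [pow_eq_zero_of_le hb.le hnil]
  by_cases ha : a ≤ n
  · exact le_iSup₂_of_le (a, b + 1) ⟨by push_cast; omega, ha, by omega, by omega⟩ (by simp)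
  · have hc : ((n - k - 1).toNat : ℤ) = n - k - 1 := Int.toNat_of_nonneg (by omega)
    refine le_iSup₂_of_le (n, (n - k - 1).toNat + 1)
      ⟨by push_cast; omega, le_rfl, by omega, by omega⟩ ?_
    rintro _ ⟨-, z, rfl⟩
    refine ⟨by simp [hnil], (θ ^ (b - (n - k - 1).toNat)) z, ?_⟩
    rw [Nat.add_sub_cancel, ← Module.End.mul_apply, ← pow_add]
    congr 2
    omega

theorem Cfilt_le {θ : M →ₗ[R] M} {n : ℕ} {k : ℤ} {S : Submodule R M}
    (h : ∀ a b : ℕ, (a : ℤ) = b + k + 1 →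
      LinearMap.ker (θ ^ a) ⊓ LinearMap.range (θ ^ b) ≤ S) :
    Cfilt θ n k ≤ S :=
  iSup₂_le fun p hp => h p.1 (p.2 - 1) (by omega)

theorem map_pow_Cfilt {θ : M →ₗ[R] M} {n : ℕ} (hnil : θ ^ n = 0) {l : ℕ} {k : ℤ}
    (hk : k ≤ (n : ℤ) - 1) (hlk : (l : ℤ) - 1 ≤ k) (hkl : k ≤ l) :
    Submodule.map (θ ^ l) (Cfilt θ n k) = Cfilt θ n (k - 2 * l) := by
  apply le_antisymm
  · rw [Submodule.map_le_iff_le_comap]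
    refine Cfilt_le fun a b hab => ?_
    rintro _ ⟨hz, z, rfl⟩
    refine ker_inf_range_le_Cfilt hnil (by omega) (a := a - l) (b := l + b) (by omega)
      ⟨?_, z, by rw [pow_add, Module.End.mul_apply]⟩
    rw [SetLike.mem_coe, LinearMap.mem_ker, ← Module.End.mul_apply, ← pow_add,
      Nat.sub_add_cancel (by omega)]
    exact hz
  · refine Cfilt_le fun a b hab => ?_
    rintro _ ⟨hz, z, rfl⟩
    obtain rfl | ha := Nat.eq_zero_or_pos a
    · have : (θ ^ b) z = 0 := by simpa using hz
      rw [this]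
      exact zero_mem _
    · obtain ⟨c, rfl⟩ := Nat.exists_eq_add_of_le (show l ≤ b by omega)
      rw [pow_add, Module.End.mul_apply] at hz ⊢
      refine Submodule.mem_map_of_mem (ker_inf_range_le_Cfilt hnil hk (a := a + l) (b := c)
        (by push_cast at hab ⊢; omega) ⟨?_, z, rfl⟩)
      rw [SetLike.mem_coe, LinearMap.mem_ker, pow_add, Module.End.mul_apply]
      exact hz

end

/-- Let `θ` be an endomorphism of a module `M` over a commutative ring, with `θ^n = 0`
and `θ^{n-1} ≠ 0`.  Then for `0 ≤ l ≤ n-1` the map `θ^l` carries `C^l(M)` onto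
`C^{-l}(M)`, and the induced map `C^l/C^{l-1} → C^{-l}/C^{-l-1}` is an isomorphism. -/
theorem stmt_6 {R M : Type*} [CommRing R] [AddCommGroup M] [Module R M]
    (θ : M →ₗ[R] M) (n : ℕ)
    (hnil : θ ^ n = 0) (hnil' : θ ^ (n - 1) ≠ 0) :
    ∀ l : ℕ, (l : ℤ) ≤ (n : ℤ) - 1 →
      -- θ^l maps C^l onto C^{-l}
      (Submodule.map (θ ^ l) (Cfilt θ n (l : ℤ)) = Cfilt θ n (-(l : ℤ))) ∧
      -- the induced map on graded pieces is well defined ...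
      (Submodule.map (θ ^ l) (Cfilt θ n ((l : ℤ) - 1)) ≤ Cfilt θ n (-(l : ℤ) - 1)) ∧
      -- ... and injective (hence, with the above, an isomorphism)
      (∀ x ∈ Cfilt θ n (l : ℤ),
        (θ ^ l) x ∈ Cfilt θ n (-(l : ℤ) - 1) → x ∈ Cfilt θ n ((l : ℤ) - 1)) := by
  intro l hl
  have hmap : Submodule.map (θ ^ l) (Cfilt θ n ((l : ℤ) - 1)) = Cfilt θ n (-(l : ℤ) - 1) := by
    rw [map_pow_Cfilt hnil (by omega) le_rfl (by omega)]
    congr 1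
    ring
  refine ⟨?_, hmap.le, fun x _ hx => ?_⟩
  · rw [map_pow_Cfilt hnil hl (by omega) le_rfl]
    congr 1
    ring
  · rw [← hmap] at hx
    obtain ⟨y, hy, hyx⟩ := hx
    have hsub : x - y ∈ Cfilt θ n ((l : ℤ) - 1) :=
      ker_inf_range_le_Cfilt hnil (by omega) (a := l) (b := 0) (by simp)
        ⟨by simp [hyx], by simp⟩
    simpa using add_mem hsub hy
end

section
/- Let k be a field, A and B local Artinian k-algebras, and q : B → A a surjective k-algebra homomorphism whose kernel I satisfies I² = 0. Let R be a commutative k-algebra which is an integral domain. Let θ : (R ⊗_k A)^m → (R ⊗_k A)^n be an injective (R ⊗_k A)-linear map, and let ψ : (R ⊗_k B)^m → (R ⊗_k B)^n be an (R ⊗_k B)-linear map lifting θ, i.e. π^n ∘ ψ = θ ∘ π^m where π = id_R ⊗ q : R ⊗_k B → R ⊗_k A is applied componentwise. Then ψ is injective. -/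
open TensorProduct

/-- Injectivity of `X ⊗ f` for flat source and target passes to extensions of `X`. -/
theorem LinearMap.lTensor_injective_of_exact {B M N X₁ X₂ X₃ : Type*} [CommRing B]
    [AddCommGroup M] [Module B M] [AddCommGroup N] [Module B N] [Module.Flat B N]
    [AddCommGroup X₁] [Module B X₁] [AddCommGroup X₂] [Module B X₂]
    [AddCommGroup X₃] [Module B X₃] (f : M →ₗ[B] N) {u : X₁ →ₗ[B] X₂} {v : X₂ →ₗ[B] X₃}
    (hu : Function.Injective u) (hv : Function.Surjective v) (huv : Function.Exact u v)
    (h₁ : Function.Injective (f.lTensor X₁)) (h₃ : Function.Injective (f.lTensor X₃)) :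
    Function.Injective (f.lTensor X₂) := by
  rw [injective_iff_map_eq_zero]
  intro x hx
  have comm_u (z : X₁ ⊗[B] M) : f.lTensor X₂ (u.rTensor M z) = u.rTensor N (f.lTensor X₁ z) := by
    rw [← LinearMap.comp_apply, ← LinearMap.comp_apply, LinearMap.lTensor_comp_rTensor,
      LinearMap.rTensor_comp_lTensor]
  have comm_v : f.lTensor X₃ (v.rTensor M x) = v.rTensor N (f.lTensor X₂ x) := by
    rw [← LinearMap.comp_apply, ← LinearMap.comp_apply, LinearMap.lTensor_comp_rTensor,
      LinearMap.rTensor_comp_lTensor]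
  have hvx : v.rTensor M x = 0 := h₃ (by rw [comm_v, hx, map_zero, map_zero])
  obtain ⟨y, rfl⟩ := (rTensor_exact M huv hv x).mp hvx
  rw [comm_u] at hx
  have hy : y = 0 := h₁ (Module.Flat.rTensor_preserves_injective_linearMap u hu
    (by rw [hx, map_zero, map_zero]))
  rw [hy, map_zero]

/-- Over a local Artinian ring, if `X ⊗ f` is injective for some nonzero `X`,
then `f` is injective, provided that its source and target are flat. -/
theorem LinearMap.injective_of_lTensor_injective {B M N X : Type*} [CommRing B]
    [IsArtinianRing B] [IsLocalRing B] [AddCommGroup M] [Module B M] [Module.Flat B M]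
    [AddCommGroup N] [Module B N] [Module.Flat B N] [AddCommGroup X] [Module B X] [Nontrivial X]
    (f : M →ₗ[B] N) (hf : Function.Injective (f.lTensor X)) : Function.Injective f := by
  obtain ⟨p, hp⟩ := associatedPrimes.nonempty B X
  have hp_prime : p.IsPrime := hp.1
  obtain ⟨i, hi⟩ := ((isAssociatedPrime_iff_exists_injective_linearMap p X).mp hp).2
  have injective_residue : Function.Injective (f.lTensor (B ⧸ p)) := by
    have h : Function.Injective (i.rTensor N ∘ₗ f.lTensor (B ⧸ p)) := by
      rw [LinearMap.rTensor_comp_lTensor, ← LinearMap.lTensor_comp_rTensor]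
      exact hf.comp (Module.Flat.rTensor_preserves_injective_linearMap i hi)
    exact Function.Injective.of_comp h
  have h : Function.Injective (f.lTensor B) := by
    refine IsNoetherianRing.induction_on_isQuotientEquivQuotientPrime (A := B) (M := B)
      inferInstance (motive := fun Y _ _ _ ↦ Function.Injective (f.lTensor Y)) ?_ ?_ ?_
    · intro Y _ _ _ _
      exact Function.injective_of_subsingleton _
    · intro Y _ _ _ P e
      have hP : P.1 = p := by
        rw [IsLocalRing.eq_maximalIdeal (IsArtinianRing.isMaximal_of_isPrime P.1),
          IsLocalRing.eq_maximalIdeal (IsArtinianRing.isMaximal_of_isPrime p)]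
      rw [hP] at e
      have h : Function.Injective (e.toLinearMap.rTensor N ∘ₗ f.lTensor Y) := by
        rw [LinearMap.rTensor_comp_lTensor, ← LinearMap.lTensor_comp_rTensor]
        exact injective_residue.comp (e.rTensor M).injective
      exact Function.Injective.of_comp h
    · intro Y₁ _ _ _ Y₂ _ _ _ Y₃ _ _ _ u v hu hv huv h₁ h₃
      exact LinearMap.lTensor_injective_of_exact f hu hv huv h₁ h₃
  intro x y hxy
  apply (TensorProduct.lid B M).symm.injective
  apply h
  simp [hxy]

/-- Over a local Artinian ring, a linear map between flat modules is injective
if it is injective modulo a proper ideal. -/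
theorem LinearMap.injective_of_mem_smul_top {B M N : Type*} [CommRing B]
    [IsArtinianRing B] [IsLocalRing B] [AddCommGroup M] [Module B M] [Module.Flat B M]
    [AddCommGroup N] [Module B N] [Module.Flat B N] {I : Ideal B} (hI : I ≠ ⊤) (f : M →ₗ[B] N)
    (hf : ∀ x, f x ∈ I • (⊤ : Submodule B N) → x ∈ I • (⊤ : Submodule B M)) :
    Function.Injective f := by
  have : Nontrivial (B ⧸ I) := Ideal.Quotient.nontrivial_iff.mpr hI
  refine LinearMap.injective_of_lTensor_injective (X := B ⧸ I) f ?_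
  rw [injective_iff_map_eq_zero]
  intro z hz
  obtain ⟨x, rfl⟩ := (TensorProduct.quotTensorEquivQuotSMul M I).symm.surjective z
  obtain ⟨x, rfl⟩ := Submodule.Quotient.mk_surjective _ x
  rw [quotTensorEquivQuotSMul_symm_mk, LinearMap.lTensor_tmul,
    ← quotTensorEquivQuotSMul_symm_mk, LinearEquiv.map_eq_zero_iff,
    Submodule.Quotient.mk_eq_zero] at hz
  rw [LinearEquiv.map_eq_zero_iff, Submodule.Quotient.mk_eq_zero]
  exact hf x hz

/-- Let `k` be a field, `q : B → A` a surjective homomorphism of local Artinian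
`k`-algebras with square-zero kernel, and `R` a `k`-algebra which is an integral
domain.  If `θ : (R ⊗_k A)^m → (R ⊗_k A)^n` is injective and
`ψ : (R ⊗_k B)^m → (R ⊗_k B)^n` lifts `θ`, then `ψ` is injective. -/
theorem stmt_10 {k : Type*} [Field k]
    {A B : Type*} [CommRing A] [Algebra k A] [IsArtinianRing A] [IsLocalRing A]
    [CommRing B] [Algebra k B] [IsArtinianRing B] [IsLocalRing B]
    (q : B →ₐ[k] A) (hq : Function.Surjective q)
    (hker : (RingHom.ker (q : B →+* A)) ^ 2 = ⊥)
    {R : Type*} [CommRing R] [IsDomain R] [Algebra k R]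
    (m n : ℕ)
    (θ : (Fin m → R ⊗[k] A) →ₗ[R ⊗[k] A] (Fin n → R ⊗[k] A))
    (hθ : Function.Injective θ)
    (ψ : (Fin m → R ⊗[k] B) →ₗ[R ⊗[k] B] (Fin n → R ⊗[k] B))
    (hlift : ∀ x : Fin m → R ⊗[k] B,
      (fun j => Algebra.TensorProduct.map (AlgHom.id k R) q (ψ x j))
        = θ (fun i => Algebra.TensorProduct.map (AlgHom.id k R) q (x i))) :
    Function.Injective ψ := by
  let : Algebra B (R ⊗[k] B) := Algebra.TensorProduct.rightAlgebra
  have : Module.Flat B (R ⊗[k] B) :=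
    .of_linearEquiv (Algebra.TensorProduct.commRight k B R).symm.toLinearEquiv
  have flat_pi (l : ℕ) : Module.Flat B (Fin l → R ⊗[k] B) := .trans B (R ⊗[k] B) _
  let π := Algebra.TensorProduct.map (AlgHom.id k R) q
  have hI : RingHom.ker (q : B →+* A) ≠ ⊤ := RingHom.ker_ne_top _
  have ker_π : RingHom.ker π = (RingHom.ker (q : B →+* A)).map (algebraMap B (R ⊗[k] B)) :=
    Algebra.TensorProduct.lTensor_ker q hq
  refine LinearMap.injective_of_mem_smul_top hI (ψ.restrictScalars B) fun y hy ↦ ?_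
  have π_zero (w : Fin n → R ⊗[k] B)
      (hw : w ∈ RingHom.ker (q : B →+* A) • (⊤ : Submodule B (Fin n → R ⊗[k] B))) (j : Fin n) :
      π (w j) = 0 := by
    induction hw using Submodule.smul_induction_on' with
    | smul b hb z _ =>
      rw [Pi.smul_apply, Algebra.smul_def, map_mul]
      have : algebraMap B (R ⊗[k] B) b ∈ RingHom.ker π :=
        ker_π ▸ Ideal.mem_map_of_mem _ hb
      rw [RingHom.mem_ker.mp this, zero_mul]
    | add z _ z' _ h h' => rw [Pi.add_apply, map_add, h, h', add_zero]
  have hθy : θ (fun i ↦ π (y i)) = 0 := by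
    rw [← hlift]
    exact funext (π_zero _ hy)
  have hy_zero := (injective_iff_map_eq_zero θ).mp hθ _ hθy
  rw [← LinearMap.sum_single_apply (fun _ ↦ R ⊗[k] B) y]
  refine Submodule.sum_mem _ fun i _ ↦ ?_
  have hyi : y i ∈ RingHom.ker (q : B →+* A) • (⊤ : Submodule B (R ⊗[k] B)) := by
    rw [Ideal.smul_top_eq_map, Submodule.restrictScalars_mem, ← ker_π]
    exact congrFun hy_zero i
  have := Submodule.mem_map_of_mem (f := LinearMap.single B (fun _ : Fin m ↦ R ⊗[k] B) i) hyi
  rw [Submodule.map_smul''] at this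
  exact Submodule.smul_mono le_rfl le_top this
end

section
/- Let k be a field of characteristic 0, A and B local Artinian k-algebras, q : B → A a surjective k-algebra homomorphism whose kernel I satisfies I² = 0, R a commutative k-algebra, and π = id_R ⊗ q : R ⊗_k B → R ⊗_k A. Let Q be an (R ⊗_k A)-bilinear form on the free module (R ⊗_k A)^{2r} which is alternating and nondegenerate (the induced map to the dual module is bijective). Then there exists an (R ⊗_k B)-bilinear form Q' on (R ⊗_k B)^{2r} which is alternating and nondegenerate and lifts Q, i.e. π(Q'(x,y)) = Q(π^{2r}(x), π^{2r}(y)) for all x, y ∈ (R ⊗_k B)^{2r}. -/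
open TensorProduct

section BilinearLift

variable {ι S T : Type*} [Fintype ι] [CommRing S] [CommRing T]

/-- A bilinear form on a finite free module is nondegenerate if and only if its Gram determinant
is a unit. -/
theorem bijective_iff_isUnit_det_gram [DecidableEq ι]
    (Q : (ι → S) →ₗ[S] (ι → S) →ₗ[S] S) :
    Function.Bijective Q ↔
      IsUnit (Matrix.of fun i j => Q (Pi.single j 1) (Pi.single i 1)).det := by
  have hgram : LinearMap.toMatrix (Pi.basisFun S ι) (Pi.basisFun S ι).dualBasis Q =
      Matrix.of fun i j => Q (Pi.single j 1) (Pi.single i 1) := by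
    ext i j
    simp [LinearMap.toMatrix_apply]
  rw [← hgram]
  constructor
  · intro h
    exact (LinearEquiv.ofBijective Q h).isUnit_det _ _
  · intro h
    exact (LinearEquiv.ofIsUnitDet h).bijective

/-- The image of a bilinear form given by a matrix under a ring homomorphism. -/
theorem map_toLinearMap₂' [DecidableEq ι] (f : S →+* T) (M : Matrix ι ι S) (x y : ι → S) :
    f (Matrix.toLinearMap₂' S M x y) =
      Matrix.toLinearMap₂' T (M.map f) (fun i => f (x i)) (fun i => f (y i)) := by
  simp [Matrix.toLinearMap₂'_apply]

/-- An alternating form is the antisymmetrization of the strictly upper triangular part of its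
Gram matrix. -/
theorem eq_sub_flip_of_alternating [LinearOrder ι]
    (Q : (ι → S) →ₗ[S] (ι → S) →ₗ[S] S) (halt : ∀ x, Q x x = 0)
    (U : (ι → S) →ₗ[S] (ι → S) →ₗ[S] S)
    (hU : ∀ i j, U (Pi.single i 1) (Pi.single j 1) =
      if i < j then Q (Pi.single i 1) (Pi.single j 1) else 0) :
    Q = U - U.flip := by
  have hneg : ∀ x y, Q y x = -Q x y := fun x y => (LinearMap.IsAlt.neg halt x y).symm
  refine (Pi.basisFun S ι).ext fun i => (Pi.basisFun S ι).ext fun j => ?_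
  rcases lt_trichotomy i j with h | rfl | h
  · simp [hU, h, h.not_gt]
  · simp [halt]
  · simp [hU, h, h.not_gt, hneg (Pi.single j 1) (Pi.single i 1)]

/-- A surjective ring homomorphism with nilpotent kernel is local. -/
theorem isLocalHom_of_surjective_of_ker_pow_eq_bot (f : S →+* T) (hf : Function.Surjective f)
    (n : ℕ) (hker : RingHom.ker f ^ n = ⊥) : IsLocalHom f := by
  refine ⟨fun a ha => ?_⟩
  obtain ⟨t, ht⟩ := ha.exists_right_inv
  obtain ⟨c, rfl⟩ := hf t
  have hmem : a * c - 1 ∈ RingHom.ker f := by simp [RingHom.mem_ker, ht]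
  have hnil : IsNilpotent (a * c - 1) :=
    ⟨n, by simpa [hker] using Ideal.pow_mem_pow hmem n⟩
  have hunit : IsUnit (a * c) := by simpa using hnil.isUnit_one_add
  exact isUnit_of_mul_isUnit_left hunit

/-- Alternating nondegenerate forms on finite free modules lift along surjective local
homomorphisms. -/
theorem exists_alternating_nondegenerate_lift [LinearOrder ι] (f : S →+* T) [IsLocalHom f]
    (hf : Function.Surjective f) (Q : (ι → T) →ₗ[T] (ι → T) →ₗ[T] T)
    (halt : ∀ x, Q x x = 0) (hnd : Function.Bijective Q) :
    ∃ Q' : (ι → S) →ₗ[S] (ι → S) →ₗ[S] S, (∀ x, Q' x x = 0) ∧ Function.Bijective Q' ∧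
      ∀ x y, f (Q' x y) = Q (fun i => f (x i)) (fun i => f (y i)) := by
  choose g hg using hf
  let M : Matrix ι ι S := Matrix.of fun i j =>
    if i < j then g (Q (Pi.single i 1) (Pi.single j 1)) else 0
  have hQ := eq_sub_flip_of_alternating Q halt (Matrix.toLinearMap₂' T (M.map f)) fun i j => by
    by_cases h : i < j <;> simp [Matrix.toLinearMap₂'_apply, Pi.single_apply, M, h, hg]
  let U : (ι → S) →ₗ[S] (ι → S) →ₗ[S] S := Matrix.toLinearMap₂' S M
  have hlift : ∀ x y : ι → S, f ((U - U.flip) x y) =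
      Q (fun i => f (x i)) (fun i => f (y i)) := by
    intro x y
    rw [hQ]
    simp only [LinearMap.sub_apply, LinearMap.flip_apply, map_sub, U, map_toLinearMap₂']
  refine ⟨U - U.flip, fun x => by simp, ?_, hlift⟩
  rw [bijective_iff_isUnit_det_gram] at hnd ⊢
  refine isUnit_of_map_unit f _ ?_
  have hsingle : ∀ i : ι, (fun l => f ((Pi.single i (1 : S) : ι → S) l)) = Pi.single i (1 : T) := by
    intro i
    ext l
    by_cases h : l = i
    · subst h; simp
    · simp [h]
  rw [RingHom.map_det]
  convert hnd using 2
  ext i j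
  rw [RingHom.mapMatrix_apply, Matrix.map_apply, Matrix.of_apply, hlift, hsingle, hsingle,
    Matrix.of_apply]

end BilinearLift

/-- Let `k` be a field of characteristic `0`, `q : B → A` a surjective homomorphism of
local Artinian `k`-algebras with square-zero kernel, `R` a commutative `k`-algebra, and
`π = id_R ⊗ q`.  Every alternating nondegenerate `(R ⊗_k A)`-bilinear form `Q` on
`(R ⊗_k A)^{2r}` lifts to an alternating nondegenerate `(R ⊗_k B)`-bilinear form `Q'`
on `(R ⊗_k B)^{2r}` with `π(Q'(x,y)) = Q(π x, π y)`. -/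
theorem stmt_11 {k : Type*} [Field k] [CharZero k]
    {A B : Type*} [CommRing A] [Algebra k A] [IsArtinianRing A] [IsLocalRing A]
    [CommRing B] [Algebra k B] [IsArtinianRing B] [IsLocalRing B]
    (q : B →ₐ[k] A) (hq : Function.Surjective q)
    (hker : (RingHom.ker (q : B →+* A)) ^ 2 = ⊥)
    {R : Type*} [CommRing R] [Algebra k R]
    (r : ℕ)
    (Q : (Fin (2 * r) → R ⊗[k] A) →ₗ[R ⊗[k] A]
          (Fin (2 * r) → R ⊗[k] A) →ₗ[R ⊗[k] A] (R ⊗[k] A))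
    (halt : ∀ x, Q x x = 0)
    (hnd : Function.Bijective fun x => Q x) :
    ∃ Q' : (Fin (2 * r) → R ⊗[k] B) →ₗ[R ⊗[k] B]
            (Fin (2 * r) → R ⊗[k] B) →ₗ[R ⊗[k] B] (R ⊗[k] B),
      (∀ x, Q' x x = 0) ∧
      (Function.Bijective fun x => Q' x) ∧
      (∀ x y : Fin (2 * r) → R ⊗[k] B,
        Algebra.TensorProduct.map (AlgHom.id k R) q (Q' x y)
          = Q (fun i => Algebra.TensorProduct.map (AlgHom.id k R) q (x i))
              (fun i => Algebra.TensorProduct.map (AlgHom.id k R) q (y i))) := by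
  have hsurj : Function.Surjective (Algebra.TensorProduct.map (AlgHom.id k R) q) :=
    TensorProduct.map_surjective Function.surjective_id hq
  have hnil : RingHom.ker (Algebra.TensorProduct.map (AlgHom.id k R) q : R ⊗[k] B →+* R ⊗[k] A)
      ^ 2 = ⊥ := by
    have h := Algebra.TensorProduct.lTensor_ker (A := R) q hq
    have h' : RingHom.ker (Algebra.TensorProduct.map (AlgHom.id k R) q :
        R ⊗[k] B →+* R ⊗[k] A) = (RingHom.ker (q : B →+* A)).map
          (Algebra.TensorProduct.includeRight : B →ₐ[k] R ⊗[k] B) := h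
    rw [h', ← Ideal.map_pow, hker, Ideal.map_bot]
  have hloc : IsLocalHom
      (Algebra.TensorProduct.map (AlgHom.id k R) q : R ⊗[k] B →+* R ⊗[k] A) := by
    exact isLocalHom_of_surjective_of_ker_pow_eq_bot _ hsurj 2 hnil
  exact exists_alternating_nondegenerate_lift
    (Algebra.TensorProduct.map (AlgHom.id k R) q : R ⊗[k] B →+* R ⊗[k] A) hsurj Q halt hnd
end

section
/- Let A be a ring and H(A) = A × Aᵒᵖ the hyperbolic ring with involution μ(a, bᵒᵖ) = (b, aᵒᵖ). Let M be a right H(A)-module with a nonsingular 1-hermitian form b with respect to μ. Put e₁ = (1, 0), e₂ = (0, 1ᵒᵖ), M₁ = Me₁ and M₂ = Me₂, where M₁ is a right A-module via m·a = m·(a,0). Then M = M₁ ⊕ M₂; b(x,y) = 0 for all x, y ∈ M₁ and for all x, y ∈ M₂; and the map sending y ∈ M₂ to the functional on M₁ given by x ↦ (first component of b(y,x)) is a bijection from M₂ onto the set of right A-linear maps M₁ → A. -/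
open MulOpposite

/-- Let `A` be a ring and `H(A) = A × Aᵒᵖ` the hyperbolic ring with involution
`μ(a, bᵒᵖ) = (b, aᵒᵖ)`.  Let `M` be a right `H(A)`-module with a nonsingular
1-hermitian form `b`.  With `e₁ = (1,0)`, `e₂ = (0,1ᵒᵖ)`, `M₁ = Me₁`, `M₂ = Me₂`
(`M₁` a right `A`-module via `m·a = m·(a,0)`): `M = M₁ ⊕ M₂`; `b` vanishes on
`M₁ × M₁` and on `M₂ × M₂`; and `y ↦ (x ↦ (b y x)₁)` is a bijection from `M₂` onto
the set of right `A`-linear maps `M₁ → A`. -/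
theorem stmt_17 {A : Type*} [Ring A]
    {M : Type*} [AddCommGroup M] [Module (A × Aᵐᵒᵖ)ᵐᵒᵖ M]
    (b : M → M → A × Aᵐᵒᵖ)
    -- b is biadditive
    (hb1 : ∀ x y z : M, b (x + y) z = b x z + b y z)
    (hb2 : ∀ x y z : M, b x (y + z) = b x y + b x z)
    -- b is sesquilinear with respect to the hyperbolic involution μ(a,bᵒᵖ) = (b,aᵒᵖ)
    (hb3 : ∀ (a a' : A × Aᵐᵒᵖ) (x y : M),
      b (op a • x) (op a' • y) = (unop a.2, op a.1) * b x y * a')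
    -- b is 1-hermitian
    (hb4 : ∀ x y : M, b x y = (unop (b y x).2, op (b y x).1))
    -- b is nonsingular
    (hinj : ∀ x x' : M, (∀ y, b x y = b x' y) → x = x')
    (hsurjf : ∀ f : M → A × Aᵐᵒᵖ, (∀ y z, f (y + z) = f y + f z) →
      (∀ (a : A × Aᵐᵒᵖ) (y : M), f (op a • y) = f y * a) →
      ∃ x, ∀ y, b x y = f y)
    (M₁ M₂ : Set M)
    (hM₁ : M₁ = Set.range fun m : M => (op ((1 : A), (0 : Aᵐᵒᵖ))) • m)
    (hM₂ : M₂ = Set.range fun m : M => (op ((0 : A), (1 : Aᵐᵒᵖ))) • m) :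
    -- M = M₁ ⊕ M₂
    (∀ m : M, ∃! p : M × M, p.1 ∈ M₁ ∧ p.2 ∈ M₂ ∧ m = p.1 + p.2) ∧
    -- b vanishes on M₁ × M₁ and on M₂ × M₂
    (∀ x ∈ M₁, ∀ y ∈ M₁, b x y = 0) ∧
    (∀ x ∈ M₂, ∀ y ∈ M₂, b x y = 0) ∧
    -- for y ∈ M₂, the functional x ↦ (b y x).1 on M₁ is right A-linear
    (∀ y ∈ M₂, (∀ x ∈ M₁, ∀ x' ∈ M₁, (b y (x + x')).1 = (b y x).1 + (b y x').1) ∧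
      ∀ a : A, ∀ x ∈ M₁, (b y ((op ((a : A), (0 : Aᵐᵒᵖ))) • x)).1 = (b y x).1 * a) ∧
    -- the assignment y ↦ (x ↦ (b y x).1) is injective on M₂ ...
    (∀ y ∈ M₂, ∀ y' ∈ M₂, (∀ x ∈ M₁, (b y x).1 = (b y' x).1) → y = y') ∧
    -- ... and hits every right A-linear functional on M₁
    (∀ f : M → A,
      (∀ x ∈ M₁, ∀ x' ∈ M₁, f (x + x') = f x + f x') →
      (∀ a : A, ∀ x ∈ M₁, f ((op ((a : A), (0 : Aᵐᵒᵖ))) • x) = f x * a) →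
      ∃ y ∈ M₂, ∀ x ∈ M₁, (b y x).1 = f x) := by
  have smul_add_eq (u v : A × Aᵐᵒᵖ) (z : M) : op u • z + op v • z = op (u + v) • z := by
    rw [op_add, add_smul]
  have smul_smul_eq (u v : A × Aᵐᵒᵖ) (z : M) : op u • op v • z = op (v * u) • z := by
    rw [smul_smul, op_mul]
  have one_smul_eq (z : M) : op (1 : A × Aᵐᵒᵖ) • z = z := by rw [op_one, one_smul]
  have zero_smul_eq (z : M) : op (0 : A × Aᵐᵒᵖ) • z = 0 := by rw [op_zero, zero_smul]
  have smul_left (u : A × Aᵐᵒᵖ) (x y : M) : b (op u • x) y = (unop u.2, op u.1) * b x y := by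
    have h := hb3 u 1 x y
    rwa [one_smul_eq, mul_one] at h
  have smul_right (u : A × Aᵐᵒᵖ) (x y : M) : b x (op u • y) = b x y * u := by
    have h := hb3 1 u x y
    rw [one_smul_eq] at h
    rw [h]
    ext <;> simp
  have decomp (z : M) : z = op ((1 : A), (0 : Aᵐᵒᵖ)) • z + op ((0 : A), (1 : Aᵐᵒᵖ)) • z := by
    rw [smul_add_eq]
    simp only [Prod.mk_add_mk, add_zero, zero_add]
    exact (one_smul_eq z).symm
  have fix₁ : ∀ x ∈ M₁, op ((1 : A), (0 : Aᵐᵒᵖ)) • x = x := by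
    rw [hM₁]
    rintro _ ⟨z, rfl⟩
    simp [smul_smul_eq]
  have fix₂ : ∀ x ∈ M₂, op ((0 : A), (1 : Aᵐᵒᵖ)) • x = x := by
    rw [hM₂]
    rintro _ ⟨z, rfl⟩
    simp [smul_smul_eq]
  have kill₁ : ∀ x ∈ M₁, op ((0 : A), (1 : Aᵐᵒᵖ)) • x = 0 := by
    intro x hx
    rw [← fix₁ x hx, smul_smul_eq]
    simp only [Prod.mk_mul_mk, mul_zero, zero_mul]
    exact zero_smul_eq x
  have kill₂ : ∀ x ∈ M₂, op ((1 : A), (0 : Aᵐᵒᵖ)) • x = 0 := by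
    intro x hx
    rw [← fix₂ x hx, smul_smul_eq]
    simp only [Prod.mk_mul_mk, mul_zero, zero_mul]
    exact zero_smul_eq x
  have mem₁ (z : M) : op ((1 : A), (0 : Aᵐᵒᵖ)) • z ∈ M₁ := hM₁ ▸ ⟨z, rfl⟩
  have mem₂ (z : M) : op ((0 : A), (1 : Aᵐᵒᵖ)) • z ∈ M₂ := hM₂ ▸ ⟨z, rfl⟩
  have form_left₂ : ∀ y ∈ M₂, ∀ z, b y z = ((b y (op ((1 : A), (0 : Aᵐᵒᵖ)) • z)).1, 0) := by
    intro y hy z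
    have h := smul_left ((0 : A), (1 : Aᵐᵒᵖ)) y z
    rw [fix₂ y hy] at h
    rw [smul_right]
    ext
    · simp
    · rw [h]
      simp
  refine ⟨fun m => ⟨(_, _), ⟨mem₁ m, mem₂ m, decomp m⟩, ?_⟩, ?_, ?_, ?_, ?_, ?_⟩
  · rintro ⟨p, q⟩ ⟨hp, hq, rfl⟩
    simp only at hp hq
    simp [smul_add, fix₁ p hp, fix₂ q hq, kill₁ p hp, kill₂ q hq]
  · intro x hx y hy
    rw [← fix₁ x hx, ← fix₁ y hy, hb3]
    ext <;> simp
  · intro x hx y hy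
    rw [← fix₂ x hx, ← fix₂ y hy, hb3]
    ext <;> simp
  · refine fun y _ => ⟨fun x _ x' _ => by rw [hb2, Prod.fst_add], fun a x _ => ?_⟩
    rw [smul_right, Prod.fst_mul]
  · intro y hy y' hy' h
    refine hinj y y' fun z => ?_
    rw [form_left₂ y hy, form_left₂ y' hy', h _ (mem₁ z)]
  · intro f hadd hsmul
    obtain ⟨x, hx⟩ := hsurjf (fun z => (f (op ((1 : A), (0 : Aᵐᵒᵖ)) • z), 0))
      (fun y z => by simp [smul_add, hadd _ (mem₁ y) _ (mem₁ z)])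
      (fun a y => by
        have h := hsmul a.1 _ (mem₁ y)
        rw [smul_smul_eq] at h
        have he : a * ((1 : A), (0 : Aᵐᵒᵖ)) = ((1 : A), (0 : Aᵐᵒᵖ)) * (a.1, 0) := by
          ext <;> simp
        rw [smul_smul_eq, he]
        ext
        · exact h
        · simp)
    refine ⟨_, mem₂ x, fun z hz => ?_⟩
    rw [smul_left, hx, fix₁ z hz]
    simp
end

section
/- Let A be a right Artinian ring and H(A) = A × Aᵒᵖ the hyperbolic ring with involution μ(a, bᵒᵖ) = (b, aᵒᵖ). Let (M, b) and (N, b') be finitely generated projective right H(A)-modules each equipped with a nonsingular 1-hermitian form with respect to μ. If M and N are isomorphic as right H(A)-modules, then there exists an H(A)-module isomorphism φ : M → N with b'(φ(x), φ(y)) = b(x, y) for all x, y ∈ M. -/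
open MulOpposite

/-- A 1-hermitian form on a right `A`-module (an `Aᵐᵒᵖ`-module) `M` with respect to an
involution `μ` on `A`. -/
def IsHermForm {A M : Type*} [Ring A] [AddCommGroup M] [Module Aᵐᵒᵖ M]
    (μ : A → A) (b : M → M → A) : Prop :=
  (∀ x y z : M, b (x + y) z = b x z + b y z) ∧
  (∀ x y z : M, b x (y + z) = b x y + b x z) ∧
  (∀ (a a' : A) (x y : M), b (op a • x) (op a' • y) = μ a * b x y * a') ∧
  (∀ x y : M, b x y = μ (b y x))

/-- Nonsingularity of a sesquilinear form: `x ↦ b(x,·)` is a bijection onto the set of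
right `A`-linear functionals on `M`. -/
def IsNonsingForm {A M : Type*} [Ring A] [AddCommGroup M] [Module Aᵐᵒᵖ M]
    (b : M → M → A) : Prop :=
  (∀ x x' : M, (∀ y, b x y = b x' y) → x = x') ∧
  ∀ f : M → A, (∀ y z, f (y + z) = f y + f z) →
    (∀ (a : A) (y : M), f (op a • y) = f y * a) →
    ∃ x, ∀ y, b x y = f y

/-- The involution on the hyperbolic ring `H(A) = A × Aᵒᵖ`, `μ(a, bᵒᵖ) = (b, aᵒᵖ)`. -/
def hypInvolution (A : Type*) [Ring A] : A × Aᵐᵒᵖ → A × Aᵐᵒᵖ :=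
  fun p => (unop p.2, op p.1)

section Isometry

variable {R M N : Type*} [Ring R] [AddCommGroup M] [Module Rᵐᵒᵖ M] [AddCommGroup N]
  [Module Rᵐᵒᵖ N] {μ : R → R} {b : M → M → R} {b' : N → N → R}

theorem IsHermForm.op_smul_left (hb : IsHermForm μ b) (a : R) (x y : M) :
    b (op a • x) y = μ a * b x y := by
  simpa using hb.2.2.1 a 1 x y

theorem IsHermForm.op_smul_right (hb : IsHermForm μ b) (hμ : μ 1 = 1) (a : R) (x y : M) :
    b x (op a • y) = b x y * a := by
  simpa [hμ] using hb.2.2.1 1 a x y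

/-- The inverse adjoint of a linear equivalence between nonsingular hermitian modules. -/
theorem IsHermForm.exists_adjoint (hμ : μ 1 = 1) (hb : IsHermForm μ b) (hbns : IsNonsingForm b)
    (hb' : IsHermForm μ b') (hbns' : IsNonsingForm b') (f : M ≃ₗ[Rᵐᵒᵖ] N) :
    ∃ g : M ≃ₗ[Rᵐᵒᵖ] N, ∀ x y : M, b' (g x) (f y) = b x y := by
  have exists_image : ∀ x : M, ∃ z : N, ∀ y : N, b' z y = b x (f.symm y) := fun x =>
    hbns'.2 (fun y => b x (f.symm y)) (fun y z => by simp [hb.2.1])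
      (fun a y => by simp [hb.op_smul_right hμ])
  choose g hg using exists_image
  let gl : M →ₗ[Rᵐᵒᵖ] N :=
    { toFun := g
      map_add' := fun x y => hbns'.1 _ _ fun z => by simp only [hb'.1, hg, hb.1]
      map_smul' := fun a x => hbns'.1 _ _ fun z => by
        induction a using MulOpposite.rec' with
        | _ a => simp only [RingHom.id_apply, hb'.op_smul_left, hg, hb.op_smul_left] }
  have injective : Function.Injective gl := fun x y h => hbns.1 _ _ fun z => by
    have h' : b' (g x) (f z) = b' (g y) (f z) := congrArg (b' · (f z)) h
    simpa [hg] using h'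
  have surjective : Function.Surjective gl := fun n => by
    obtain ⟨x, hx⟩ := hbns.2 (fun y => b' n (f y)) (fun y z => by simp [hb'.2.1])
      (fun a y => by simp [hb'.op_smul_right hμ])
    exact ⟨x, hbns'.1 _ _ fun y => by simp [gl, hg, hx]⟩
  exact ⟨LinearEquiv.ofBijective gl ⟨injective, surjective⟩, fun x y => (hg x (f y)).trans (by simp)⟩

/-- If the ring has a central idempotent `e` with `μ e = 1 - e`, then nonsingular hermitian
modules which are isomorphic as modules are isometric. -/
theorem IsHermForm.exists_isometry (hμ : μ 1 = 1) {e : R} (he : IsIdempotentElem e)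
    (hcomm : ∀ a, Commute e a) (hμe : μ e = 1 - e) (hμe' : μ (1 - e) = e)
    (hb : IsHermForm μ b) (hbns : IsNonsingForm b)
    (hb' : IsHermForm μ b') (hbns' : IsNonsingForm b') (f : M ≃ₗ[Rᵐᵒᵖ] N) :
    ∃ φ : M ≃ₗ[Rᵐᵒᵖ] N, ∀ x y : M, b' (φ x) (φ y) = b x y := by
  obtain ⟨g, hg⟩ := hb.exists_adjoint hμ hbns hb' hbns' f
  have hg' : ∀ x y : M, b' (f x) (g y) = b x y := fun x y => by
    rw [hb'.2.2.2, hg, ← hb.2.2.2]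
  have hee : e * e = e := he
  let φ : M →ₗ[Rᵐᵒᵖ] N :=
    { toFun := fun x => op e • f x + op (1 - e) • g x
      map_add' := fun x y => by simp only [map_add, smul_add]; abel
      map_smul' := fun a x => by
        induction a using MulOpposite.rec' with
        | _ a =>
          have h : Commute (1 - e) a := (Commute.one_left a).sub_left (hcomm a)
          simp only [map_smul, RingHom.id_apply, smul_add, smul_smul, ← op_mul,
            (hcomm a).eq, h.eq] }
  have isometry : ∀ x y, b' (φ x) (φ y) = b x y := fun x y => by
    change b' (op e • f x + op (1 - e) • g x) (op e • f y + op (1 - e) • g y) = b x y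
    have h₁ : ∀ c : R, e * c * e = e * c := fun c => by
      rw [mul_assoc, ← (hcomm c).eq, ← mul_assoc, hee]
    simp only [hb'.1, hb'.2.1, hb'.2.2.1, hg, hg', hμe, hμe', sub_mul, mul_sub, one_mul, mul_one,
      h₁, ← (hcomm _).eq]
    simp only [← mul_assoc, hee]
    abel
  have injective : Function.Injective φ := fun x y h => hbns.1 _ _ fun z => by
    rw [← isometry, h, isometry]
  have surjective : Function.Surjective φ := fun n => by
    refine ⟨op e • f.symm n + op (1 - e) • g.symm n, ?_⟩
    change op e • f _ + op (1 - e) • g _ = n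
    have h₁ : e * (1 - e) = 0 := by rw [mul_sub, hee, mul_one, sub_self]
    have h₂ : (1 - e) * e = 0 := by rw [sub_mul, hee, one_mul, sub_self]
    simp only [map_add, map_smul, smul_add, smul_smul, ← op_mul, h₁, h₂, hee,
      he.one_sub.eq, LinearEquiv.apply_symm_apply, op_zero, zero_smul, add_zero, zero_add]
    rw [← add_smul, ← op_add, add_sub_cancel, op_one, one_smul]
  exact ⟨LinearEquiv.ofBijective φ ⟨injective, surjective⟩, isometry⟩

end Isometry

/-- Let `A` be a right Artinian ring and `H(A) = A × Aᵒᵖ` the hyperbolic ring with its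
involution.  If `(M,b)` and `(N,b')` are finitely generated projective right
`H(A)`-modules with nonsingular 1-hermitian forms and `M ≅ N` as `H(A)`-modules, then
there is an `H(A)`-module isomorphism `φ : M → N` with `b'(φx, φy) = b(x,y)`. -/
theorem stmt_18 {A : Type*} [Ring A] [IsArtinianRing Aᵐᵒᵖ]
    {M N : Type*} [AddCommGroup M] [Module (A × Aᵐᵒᵖ)ᵐᵒᵖ M]
    [AddCommGroup N] [Module (A × Aᵐᵒᵖ)ᵐᵒᵖ N]
    [Module.Finite (A × Aᵐᵒᵖ)ᵐᵒᵖ M] [Module.Projective (A × Aᵐᵒᵖ)ᵐᵒᵖ M]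
    [Module.Finite (A × Aᵐᵒᵖ)ᵐᵒᵖ N] [Module.Projective (A × Aᵐᵒᵖ)ᵐᵒᵖ N]
    (b : M → M → A × Aᵐᵒᵖ) (b' : N → N → A × Aᵐᵒᵖ)
    (hb : IsHermForm (hypInvolution A) b) (hbns : IsNonsingForm b)
    (hb' : IsHermForm (hypInvolution A) b') (hbns' : IsNonsingForm b')
    (hiso : Nonempty (M ≃ₗ[(A × Aᵐᵒᵖ)ᵐᵒᵖ] N)) :
    ∃ φ : M ≃ₗ[(A × Aᵐᵒᵖ)ᵐᵒᵖ] N, ∀ x y : M, b' (φ x) (φ y) = b x y := by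
  obtain ⟨f⟩ := hiso
  exact hb.exists_isometry (e := (1, 0)) (by simp [hypInvolution]) (by simp [IsIdempotentElem])
    (fun a => by simp [commute_iff_eq, Prod.ext_iff]) (by simp [hypInvolution, Prod.ext_iff])
    (by simp [hypInvolution]) hbns hb' hbns' f
end
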